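/- arXiv:1607.07827 — 3 statements merged into one kernel-verified Lean document; each statement's English description precedes it below -/
import Mathlib

section
/- Suppose q is a power of a prime p ≠ 3. Order the six GL_2(F_q)-orbits on binary cubic forms as O_1 = {0}, O_2 = orbit of v^3, O_3 = orbit of uv^2, O_4 = orbit of uv(u−v), O_5 = orbit of v·(irreducible quadratic), O_6 = orbit of an irreducible cubic, and let e_i be the indicator of O_i. Then for y ∈ O_i one has q^4 · \hat{e_j}(y) = m_{ij}, where the matrix (m_{ij}) has rows: row 1: [1, q^2−1, q^3−q, (q^2−1)(q^2−q)/6, (q^2−1)(q^2−q)/2, (q^2−1)(q^2−q)/3]; row 2: [1, −1, q^2−q, q(q−1)(2q−1)/6, −q(q−1)/2, −q(q^2−1)/3]; row 3: [1, q−1, q^2−2q, −3q(q−1)/6, −q(q−1)/2, 0]; row 4: [1, 2q−1, −3q, q(5±q)/6, −q(−1±q)/2, q(−1±q)/3]; row 5: [1, −1, −q, −q(−1±q)/6, q(1±q)/2, −q(−1±q)/3]; row 6: [1, −q−1, 0, q(−1±q)/6, −q(−1±q)/2, q(2±q)/3]; where in the lower-right 3×3 block the sign is + if q ≡ 1 (mod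 3) and − if q ≡ 2 (mod 3). -/
open scoped Classical
open MvPolynomial Matrix

noncomputable section

/-- The standard additive character `t ↦ exp(2πi·Tr_{F/F_p}(t)/p)` of a finite field `F`
of characteristic `p`. -/
def psiF (p : ℕ) [Fact p.Prime] (F : Type*) [Field F] [Fintype F] [CharP F p] (t : F) : ℂ :=
  letI : Algebra (ZMod p) F := ZMod.algebra F p
  Complex.exp (2 * Real.pi * Complex.I * ((Algebra.trace (ZMod p) F t).val : ℂ) / (p : ℂ))

variable {F : Type*} [Field F] [Fintype F]

/-- The binary cubic form `a u³ + b u²v + c uv² + d v³` attached to `(a,b,c,d)`. -/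
def toPoly (x : Fin 4 → F) : MvPolynomial (Fin 2) F :=
  C (x 0) * X 0 ^ 3 + C (x 1) * X 0 ^ 2 * X 1 + C (x 2) * X 0 * X 1 ^ 2 + C (x 3) * X 1 ^ 3

/-- Substitution corresponding to the linear change of variables `(u,v) ↦ (u,v)·g`. -/
def subst2 (g : Matrix (Fin 2) (Fin 2) F) (P : MvPolynomial (Fin 2) F) : MvPolynomial (Fin 2) F :=
  aeval (fun j => ∑ i : Fin 2, C (g i j) * X i) P

/-- The twisted `GL₂`-action `(g∘x)(u,v) = det(g)⁻¹ · x((u,v)g)` on binary cubic forms. -/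
def act (g : Matrix.GeneralLinearGroup (Fin 2) F) (P : MvPolynomial (Fin 2) F) :
    MvPolynomial (Fin 2) F :=
  C ((g : Matrix (Fin 2) (Fin 2) F).det)⁻¹ * subst2 (g : Matrix (Fin 2) (Fin 2) F) P

/-- `x` lies in the `GL₂(F)`-orbit of `r` (binary cubic forms). -/
def InOrbit (r x : Fin 4 → F) : Prop :=
  ∃ g : Matrix.GeneralLinearGroup (Fin 2) F, act g (toPoly r) = toPoly x

/-- The bilinear form `[x,x'] = aa' + bb'/3 + cc'/3 + dd'` on binary cubic forms. -/
def bformBC (x y : Fin 4 → F) : F :=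
  x 0 * y 0 + x 1 * y 1 / 3 + x 2 * y 2 / 3 + x 3 * y 3

/-- The Fourier transform on the space of binary cubic forms over `F`. -/
def FTBC (p : ℕ) [Fact p.Prime] [CharP F p] (Φ : (Fin 4 → F) → ℂ) (y : Fin 4 → F) : ℂ :=
  ((Fintype.card F : ℂ) ^ 4)⁻¹ * ∑ x : Fin 4 → F, Φ x * psiF p F (bformBC x y)

theorem psiF_eq_stdAddChar (p : ℕ) [Fact p.Prime] [CharP F p] :
    letI : Algebra (ZMod p) F := ZMod.algebra F p
    psiF p F = ZMod.stdAddChar.compAddMonoidHom (Algebra.trace (ZMod p) F).toAddMonoidHom := by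
  let _ : Algebra (ZMod p) F := ZMod.algebra F p
  funext t
  change _ = ZMod.stdAddChar (Algebra.trace (ZMod p) F t)
  rw [ZMod.stdAddChar_apply, ZMod.toCircle_apply, psiF]

theorem psiF_add (p : ℕ) [Fact p.Prime] [CharP F p] (s t : F) :
    psiF p F (s + t) = psiF p F s * psiF p F t := by
  rw [psiF_eq_stdAddChar, AddChar.map_add_eq_mul]

theorem sum_psiF_mul (p : ℕ) [Fact p.Prime] [CharP F p] (c : F) :
    ∑ t : F, psiF p F (t * c) = if c = 0 then (Fintype.card F : ℂ) else 0 := by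
  let _ : Algebra (ZMod p) F := ZMod.algebra F p
  rw [psiF_eq_stdAddChar]
  set χ : AddChar F ℂ :=
    ZMod.stdAddChar.compAddMonoidHom (Algebra.trace (ZMod p) F).toAddMonoidHom with hχ
  have hne : χ ≠ 1 := by
    obtain ⟨t, ht⟩ := Algebra.trace_surjective (ZMod p) F 1
    intro h
    have h1 : ZMod.stdAddChar (Algebra.trace (ZMod p) F t) = (1 : ℂ) := by
      change χ t = 1
      simp [h]
    rw [ht, ← (ZMod.stdAddChar (N := p)).map_zero_eq_one] at h1
    exact one_ne_zero (ZMod.injective_stdAddChar h1)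
  have := AddChar.sum_mulShift c (AddChar.IsPrimitive.of_ne_one hne)
  rw [this]
  push_cast
  rfl

/-- The twisted action on coefficient vectors. -/
def coeffAct (g : Matrix (Fin 2) (Fin 2) F) (x : Fin 4 → F) : Fin 4 → F :=
  ![g.det⁻¹ * (x 0 * g 0 0 ^ 3 + x 1 * g 0 0 ^ 2 * g 0 1 + x 2 * g 0 0 * g 0 1 ^ 2
      + x 3 * g 0 1 ^ 3),
    g.det⁻¹ * (3 * x 0 * g 0 0 ^ 2 * g 1 0 + x 1 * (g 0 0 ^ 2 * g 1 1 + 2 * g 0 0 * g 1 0 * g 0 1)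
      + x 2 * (g 1 0 * g 0 1 ^ 2 + 2 * g 0 0 * g 0 1 * g 1 1) + 3 * x 3 * g 0 1 ^ 2 * g 1 1),
    g.det⁻¹ * (3 * x 0 * g 0 0 * g 1 0 ^ 2 + x 1 * (g 1 0 ^ 2 * g 0 1 + 2 * g 0 0 * g 1 0 * g 1 1)
      + x 2 * (g 0 0 * g 1 1 ^ 2 + 2 * g 1 0 * g 0 1 * g 1 1) + 3 * x 3 * g 0 1 * g 1 1 ^ 2),
    g.det⁻¹ * (x 0 * g 1 0 ^ 3 + x 1 * g 1 0 ^ 2 * g 1 1 + x 2 * g 1 0 * g 1 1 ^ 2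
      + x 3 * g 1 1 ^ 3)]

theorem act_toPoly (g : GeneralLinearGroup (Fin 2) F) (x : Fin 4 → F) :
    act g (toPoly x) = toPoly (coeffAct g x) := by
  simp only [act, subst2, toPoly, coeffAct, Fin.sum_univ_two, map_add, map_mul, map_pow, aeval_X,
    algHom_C, algebraMap_eq, cons_val, map_ofNat]
  ring

theorem toPoly_injective : Function.Injective (toPoly : (Fin 4 → F) → _) := by
  intro x y h
  have h' := congrArg (MvPolynomial.aeval ![(Polynomial.X : Polynomial F), 1]) h
  simp only [toPoly, map_add, map_mul, map_pow, aeval_X, algHom_C, cons_val, one_pow, mul_one,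
    Polynomial.algebraMap_eq] at h'
  funext i
  fin_cases i
  · simpa [Polynomial.coeff_X, Polynomial.coeff_C] using congrArg (Polynomial.coeff · 3) h'
  · simpa [Polynomial.coeff_X, Polynomial.coeff_C] using congrArg (Polynomial.coeff · 2) h'
  · simpa [Polynomial.coeff_X, Polynomial.coeff_C] using congrArg (Polynomial.coeff · 1) h'
  · simpa [Polynomial.coeff_X, Polynomial.coeff_C] using congrArg (Polynomial.coeff · 0) h'

theorem inOrbit_iff {r x : Fin 4 → F} :
    InOrbit r x ↔ ∃ g : GeneralLinearGroup (Fin 2) F, coeffAct g r = x := by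
  simp only [InOrbit, act_toPoly, toPoly_injective.eq_iff]

theorem coeffAct_one (x : Fin 4 → F) : coeffAct 1 x = x := by
  funext i
  fin_cases i <;> simp [coeffAct]

theorem coeffAct_mul (g h : Matrix (Fin 2) (Fin 2) F) (x : Fin 4 → F) :
    coeffAct (g * h) x = coeffAct g (coeffAct h x) := by
  funext i
  fin_cases i <;>
    simp [coeffAct, mul_apply, Fin.sum_univ_two, -mul_eq_mul_left_iff] <;> ring

theorem bformBC_coeffAct (h3 : (3 : F) ≠ 0) (g : Matrix (Fin 2) (Fin 2) F) (x y : Fin 4 → F) :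
    bformBC (coeffAct g x) y = bformBC x (coeffAct gᵀ y) := by
  simp only [coeffAct, bformBC, det_transpose, transpose_apply, cons_val]
  field_simp
  ring

theorem InOrbit.trans {x y z : Fin 4 → F} (h₁ : InOrbit x y) (h₂ : InOrbit y z) : InOrbit x z := by
  rw [inOrbit_iff] at *
  obtain ⟨g, rfl⟩ := h₁
  obtain ⟨h, rfl⟩ := h₂
  exact ⟨h * g, by rw [Units.val_mul, coeffAct_mul]⟩

theorem InOrbit.symm {x y : Fin 4 → F} (h₁ : InOrbit x y) : InOrbit y x := by
  rw [inOrbit_iff] at *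
  obtain ⟨g, rfl⟩ := h₁
  exact ⟨g⁻¹, by rw [← coeffAct_mul, ← Units.val_mul, inv_mul_cancel, Units.val_one, coeffAct_one]⟩

/-- The number of `g ∈ GL₂(F)` for which the coefficients of `g ∘ x` indexed by `S` vanish. -/
def vanishCount (S : Finset (Fin 4)) (x : Fin 4 → F) : ℕ :=
  Finset.card {g : GeneralLinearGroup (Fin 2) F | ∀ i ∈ S, coeffAct g x i = 0}

theorem vanishCount_coeffAct (S : Finset (Fin 4)) (h : GeneralLinearGroup (Fin 2) F)
    (x : Fin 4 → F) : vanishCount S (coeffAct h x) = vanishCount S x := by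
  refine Finset.card_equiv (Equiv.mulRight h) fun g => ?_
  simp [coeffAct_mul]

theorem vanishCount_eq_of_inOrbit (S : Finset (Fin 4)) {r x : Fin 4 → F} (h : InOrbit r x) :
    vanishCount S x = vanishCount S r := by
  obtain ⟨g, rfl⟩ := inOrbit_iff.1 h
  exact vanishCount_coeffAct S g r

/-- The linear automorphism of the space of forms given by `g`. -/
def coeffActEquiv (g : GeneralLinearGroup (Fin 2) F) : (Fin 4 → F) ≃ (Fin 4 → F) where
  toFun := coeffAct g
  invFun := coeffAct (g⁻¹ : GeneralLinearGroup (Fin 2) F)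
  left_inv x := by rw [← coeffAct_mul, ← Units.val_mul, inv_mul_cancel, Units.val_one, coeffAct_one]
  right_inv x := by
    rw [← coeffAct_mul, ← Units.val_mul, mul_inv_cancel, Units.val_one, coeffAct_one]

theorem sum_coordinate_subspace (p : ℕ) [Fact p.Prime] [CharP F p] (h3 : (3 : F) ≠ 0)
    (S : Finset (Fin 4)) (z : Fin 4 → F) :
    ∑ x : Fin 4 → F, (if ∀ i ∈ S, x i = 0 then (1 : ℂ) else 0) * psiF p F (bformBC x z)
      = (Fintype.card F : ℂ) ^ (Sᶜ).card * if ∀ i ∈ Sᶜ, z i = 0 then 1 else 0 := by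
  have hκ : ∀ i : Fin 4, (![1, 3⁻¹, 3⁻¹, 1] : Fin 4 → F) i ≠ 0 := by
    intro i
    fin_cases i <;> simp [h3]
  set κ : Fin 4 → F := ![1, 3⁻¹, 3⁻¹, 1] with hκd
  have hfac : ∀ x : Fin 4 → F,
      (if ∀ i ∈ S, x i = 0 then (1 : ℂ) else 0) * psiF p F (bformBC x z)
        = ∏ i, (if i ∈ S → x i = 0 then (1 : ℂ) else 0) * psiF p F (x i * (κ i * z i)) := by
    intro x
    rw [Finset.prod_mul_distrib, Finset.prod_ite_zero, Finset.prod_const_one, Fin.prod_univ_four,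
      ← psiF_add, ← psiF_add, ← psiF_add]
    congr 2
    · simp
    · simp [bformBC, hκd]
      ring
  have h0 : psiF p F 0 = 1 := by simp [psiF]
  simp_rw [hfac]
  rw [← Fintype.piFinset_univ, ← Finset.prod_univ_sum (fun _ => Finset.univ)
    (fun i t => (if i ∈ S → t = 0 then (1 : ℂ) else 0) * psiF p F (t * (κ i * z i)))]
  have hone : ∀ i : Fin 4,
      ∑ t : F, (if i ∈ S → t = 0 then (1 : ℂ) else 0) * psiF p F (t * (κ i * z i))
        = (if i ∈ Sᶜ then (Fintype.card F : ℂ) else 1) *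
          if i ∈ Sᶜ → z i = 0 then 1 else 0 := by
    intro i
    by_cases hi : i ∈ S
    · simp [hi, h0]
    · simp [hi, sum_psiF_mul, hκ i]
  simp_rw [hone]
  rw [Finset.prod_mul_distrib, Finset.prod_ite_zero, Finset.prod_ite_mem]
  simp

/-- Transposition as a permutation of `GL₂(F)`. -/
def transposeEquiv : GeneralLinearGroup (Fin 2) F ≃ GeneralLinearGroup (Fin 2) F where
  toFun g := ⟨(g : Matrix (Fin 2) (Fin 2) F)ᵀ, ((g⁻¹ : GeneralLinearGroup (Fin 2) F) : Matrix _ _ F)ᵀ,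
    by rw [← transpose_mul, ← Units.val_mul, inv_mul_cancel, Units.val_one, transpose_one],
    by rw [← transpose_mul, ← Units.val_mul, mul_inv_cancel, Units.val_one, transpose_one]⟩
  invFun g := ⟨(g : Matrix (Fin 2) (Fin 2) F)ᵀ, ((g⁻¹ : GeneralLinearGroup (Fin 2) F) : Matrix _ _ F)ᵀ,
    by rw [← transpose_mul, ← Units.val_mul, inv_mul_cancel, Units.val_one, transpose_one],
    by rw [← transpose_mul, ← Units.val_mul, mul_inv_cancel, Units.val_one, transpose_one]⟩
  left_inv g := by ext; simp
  right_inv g := by ext; simp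

theorem sum_vanishCount_mul_psiF (p : ℕ) [Fact p.Prime] [CharP F p] (h3 : (3 : F) ≠ 0)
    (S : Finset (Fin 4)) (y : Fin 4 → F) :
    ∑ x : Fin 4 → F, (vanishCount S x : ℂ) * psiF p F (bformBC x y)
      = (Fintype.card F : ℂ) ^ (Sᶜ).card * vanishCount Sᶜ y := by
  have key : ∀ g : GeneralLinearGroup (Fin 2) F,
      ∑ x : Fin 4 → F, (if ∀ i ∈ S, coeffAct g x i = 0 then (1 : ℂ) else 0) *
          psiF p F (bformBC x y)
        = (Fintype.card F : ℂ) ^ (Sᶜ).card *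
          if ∀ i ∈ Sᶜ, coeffAct (transposeEquiv g⁻¹ : GeneralLinearGroup (Fin 2) F) y i = 0
            then 1 else 0 := by
    intro g
    rw [← sum_coordinate_subspace p h3]
    refine Fintype.sum_equiv (coeffActEquiv g) _ _ fun x => ?_
    congr 2
    have : x = coeffAct (g⁻¹ : GeneralLinearGroup (Fin 2) F) (coeffActEquiv g x) :=
      ((coeffActEquiv g).left_inv x).symm
    conv_lhs => rw [this]
    exact bformBC_coeffAct h3 _ _ _
  simp_rw [vanishCount, Finset.card_filter, Nat.cast_sum, Finset.sum_mul]
  rw [Finset.sum_comm]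
  push_cast
  simp_rw [key]
  rw [← Finset.mul_sum]
  congr 1
  exact Fintype.sum_equiv ((Equiv.inv _).trans transposeEquiv) _ _ fun g => rfl

theorem inOrbit_of_eq {r x : Fin 4 → F} (a b c d : F) (hdet : a * d - b * c ≠ 0)
    (h : ∀ i, coeffAct !![a, b; c, d] r i = x i) : InOrbit r x :=
  inOrbit_iff.2 ⟨GeneralLinearGroup.mkOfDetNeZero !![a, b; c, d] (by rwa [det_fin_two_of]),
    funext h⟩

theorem inOrbit_smul {k : F} (hk : k ≠ 0) (x : Fin 4 → F) : InOrbit x (k • x) := by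
  refine inOrbit_of_eq k 0 0 k (by simpa) fun i => ?_
  fin_cases i <;> simp [coeffAct] <;> field_simp

theorem exists_extension_with_roots.{u} {F : Type u} [Field F] [Finite F] {f g : Polynomial F}
    (hf : Irreducible f) (hg : Irreducible g) (hfg : f.natDegree = g.natDegree) :
    ∃ (K : Type u) (_ : Field K) (_ : Algebra F K) (_ : FiniteDimensional F K) (s t : K),
      Module.finrank F K = f.natDegree ∧ Polynomial.aeval s f = 0 ∧ Polynomial.aeval t g = 0 ∧
        ∀ P : Polynomial F, P.degree < f.degree → Polynomial.aeval s P = 0 → P = 0 := by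
  have : Fact (Irreducible f) := ⟨hf⟩
  have : Fact (Irreducible g) := ⟨hg⟩
  have hfin := (AdjoinRoot.powerBasis hf.ne_zero).finite
  have := (AdjoinRoot.powerBasis hg.ne_zero).finite
  have := Module.finite_of_finite F (M := AdjoinRoot f)
  have hfr : Module.finrank F (AdjoinRoot f) = f.natDegree := by
    rw [(AdjoinRoot.powerBasis hf.ne_zero).finrank, AdjoinRoot.powerBasis_dim]
  obtain ⟨φ⟩ := FiniteField.nonempty_algHom_of_finrank_dvd (F := F) (K := AdjoinRoot g)
    (L := AdjoinRoot f) (by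
      rw [hfr, (AdjoinRoot.powerBasis hg.ne_zero).finrank, AdjoinRoot.powerBasis_dim, hfg])
  refine ⟨AdjoinRoot f, inferInstance, inferInstance, hfin, AdjoinRoot.root f,
    φ (AdjoinRoot.root g), hfr, ?_, ?_, fun P hP h => ?_⟩
  · rw [AdjoinRoot.aeval_eq, AdjoinRoot.mk_self]
  · rw [Polynomial.aeval_algHom_apply, AdjoinRoot.aeval_eq, AdjoinRoot.mk_self, map_zero]
  · rw [AdjoinRoot.aeval_eq, AdjoinRoot.mk_eq_zero] at h
    exact Polynomial.eq_zero_of_dvd_of_degree_lt h hP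

theorem exists_linear_relation {K : Type*} [Field K] [Algebra F K] {n : ℕ}
    [FiniteDimensional F K] (hn : Module.finrank F K < n) (v : Fin n → K) :
    ∃ c : Fin n → F, c ≠ 0 ∧ ∑ i, algebraMap F K (c i) * v i = 0 := by
  have := LinearMap.ker_ne_bot_of_finrank_lt (f := Fintype.linearCombination F v) (by simpa)
  obtain ⟨c, hc, hc0⟩ := (Submodule.ne_bot_iff _).1 this
  exact ⟨c, hc0, by simpa [Fintype.linearCombination_apply, Algebra.smul_def] using hc⟩

theorem inOrbit_irreducible_quadratic {a₂ b₂ : F}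
    (h2 : Irreducible (Polynomial.X ^ 2 + Polynomial.C a₂ * Polynomial.X + Polynomial.C b₂ :
      Polynomial F)) {b c d : F} (hb : b ≠ 0) (hno : ∀ s, b * s ^ 2 + c * s + d ≠ 0) :
    InOrbit ![0, 1, a₂, b₂] ![0, b, c, d] := by
  set f := (Polynomial.X ^ 2 + Polynomial.C a₂ * Polynomial.X + Polynomial.C b₂ :
    Polynomial F) with hf
  set g := (Polynomial.C b * Polynomial.X ^ 2 + Polynomial.C c * Polynomial.X + Polynomial.C d :
    Polynomial F) with hg
  have hfd : f.natDegree = 2 := by rw [hf]; compute_degree!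
  have hfd' : f.degree = 2 := by rw [hf]; compute_degree!
  have hgd : g.natDegree = 2 := Polynomial.natDegree_quadratic hb
  have hgi : Irreducible g := by
    refine Polynomial.irreducible_of_degree_le_three_of_not_isRoot (by simp [hgd]) fun s hs => ?_
    exact hno s (by simpa [hg, Polynomial.IsRoot] using hs)
  obtain ⟨K, _, _, _, θ, t, hfr, hθ, ht, hmin⟩ :=
    exists_extension_with_roots h2 hgi (hfd.trans hgd.symm)
  have hθf : θ ^ 2 + algebraMap F K a₂ * θ + algebraMap F K b₂ = 0 := by
    simpa [hf] using hθ
  have htg : algebraMap F K b * t ^ 2 + algebraMap F K c * t + algebraMap F K d = 0 := by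
    simpa [hg] using ht
  have indep : ∀ m n : F, algebraMap F K m * θ + algebraMap F K n = 0 → m = 0 ∧ n = 0 := by
    intro m n h
    have := hmin
      (Polynomial.C m * Polynomial.X + Polynomial.C n)
      (by rw [hfd']; exact lt_of_le_of_lt Polynomial.degree_linear_le (by norm_num))
      (by simpa using h)
    exact ⟨by simpa using congrArg (Polynomial.coeff · 1) this,
      by simpa using congrArg (Polynomial.coeff · 0) this⟩
  obtain ⟨e, he0, he⟩ := exists_linear_relation (F := F) (n := 3) (by omega) ![1, θ, t]
  simp only [Fin.sum_univ_three, cons_val, mul_one] at he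
  have he2 : e 2 ≠ 0 := by
    intro h
    obtain ⟨h1, h0⟩ := indep (e 1) (e 0) (by rw [h, map_zero] at he; linear_combination he)
    exact he0 (by ext i; fin_cases i <;> simpa)
  obtain ⟨k, l, hkl⟩ : ∃ k l : F, t = algebraMap F K k + algebraMap F K l * θ := by
    refine ⟨-(e 0 / e 2), -(e 1 / e 2), ?_⟩
    have : algebraMap F K (e 2) ≠ 0 := by simpa
    simp only [map_neg, map_div₀]
    field_simp
    linear_combination he
  obtain ⟨h1, h0⟩ := indep (-b * l ^ 2 * a₂ + 2 * b * k * l + c * l)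
    (-b * l ^ 2 * b₂ + b * k ^ 2 + c * k + d) (by
      subst hkl
      simp only [map_add, map_mul, map_neg, map_pow, map_ofNat]
      linear_combination htg - algebraMap F K b * algebraMap F K l ^ 2 * hθf)
  have hl : l ≠ 0 := by
    rintro rfl
    exact hno k (by linear_combination h0)
  have hbl : b * l ≠ 0 := mul_ne_zero hb hl
  refine (inOrbit_smul hbl _).trans (InOrbit.symm (inOrbit_of_eq l 0 k 1 (by simpa) fun i => ?_))
  fin_cases i <;> simp [coeffAct] <;> field_simp
  · refine mul_left_cancel₀ hl ?_
    linear_combination h1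
  · linear_combination h0

theorem inOrbit_irreducible_cubic {a₃ b₃ c₃ : F}
    (h3 : Irreducible (Polynomial.X ^ 3 + Polynomial.C a₃ * Polynomial.X ^ 2 +
      Polynomial.C b₃ * Polynomial.X + Polynomial.C c₃ : Polynomial F)) {a b c d : F} (ha : a ≠ 0)
    (hno : ∀ s, a * s ^ 3 + b * s ^ 2 + c * s + d ≠ 0) :
    InOrbit ![1, a₃, b₃, c₃] ![a, b, c, d] := by
  set f := (Polynomial.X ^ 3 + Polynomial.C a₃ * Polynomial.X ^ 2 +
      Polynomial.C b₃ * Polynomial.X + Polynomial.C c₃ : Polynomial F) with hf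
  set g := (Polynomial.C a * Polynomial.X ^ 3 + Polynomial.C b * Polynomial.X ^ 2 +
    Polynomial.C c * Polynomial.X + Polynomial.C d : Polynomial F) with hg
  have hfd : f.natDegree = 3 := by rw [hf]; compute_degree!
  have hfd' : f.degree = 3 := by rw [hf]; compute_degree!
  have hgd : g.natDegree = 3 := Polynomial.natDegree_cubic ha
  have hgi : Irreducible g := by
    refine Polynomial.irreducible_of_degree_le_three_of_not_isRoot (by simp [hgd]) fun s hs => ?_
    exact hno s (by simpa [hg, Polynomial.IsRoot] using hs)
  obtain ⟨K, _, _, _, θ, t, hfr, hθ, ht, hmin⟩ :=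
    exists_extension_with_roots h3 hgi (hfd.trans hgd.symm)
  have hθf : θ ^ 3 + algebraMap F K a₃ * θ ^ 2 + algebraMap F K b₃ * θ + algebraMap F K c₃ = 0 := by
    simpa [hf] using hθ
  have htg : algebraMap F K a * t ^ 3 + algebraMap F K b * t ^ 2 + algebraMap F K c * t
      + algebraMap F K d = 0 := by
    simpa [hg] using ht
  have indep : ∀ l m n : F, algebraMap F K l * θ ^ 2 + algebraMap F K m * θ + algebraMap F K n = 0 →
      l = 0 ∧ m = 0 ∧ n = 0 := by
    intro l m n h
    have := hmin
      (Polynomial.C l * Polynomial.X ^ 2 + Polynomial.C m * Polynomial.X + Polynomial.C n)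
      (by rw [hfd']; exact lt_of_le_of_lt Polynomial.degree_quadratic_le (by norm_num))
      (by simpa using h)
    exact ⟨by simpa [Polynomial.coeff_X, Polynomial.coeff_C] using congrArg (Polynomial.coeff · 2) this,
      by simpa [Polynomial.coeff_X, Polynomial.coeff_C] using congrArg (Polynomial.coeff · 1) this,
      by simpa [Polynomial.coeff_X, Polynomial.coeff_C] using congrArg (Polynomial.coeff · 0) this⟩
  have not_base : ∀ s : F, t ≠ algebraMap F K s := by
    rintro s rfl
    refine hno s ((algebraMap F K).injective ?_)
    simpa using htg
  obtain ⟨e, he0, he⟩ := exists_linear_relation (F := F) (n := 4) (by omega) ![1, θ, t, θ * t]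
  simp only [Fin.sum_univ_four, cons_val, mul_one] at he
  have he23 : ¬ (e 2 = 0 ∧ e 3 = 0) := by
    rintro ⟨h2, h3⟩
    obtain ⟨-, h1, h0⟩ := indep 0 (e 1) (e 0) (by
      rw [h2, h3, map_zero] at he; rw [map_zero]; linear_combination he)
    exact he0 (by ext i; fin_cases i <;> simpa)
  have hQ : algebraMap F K (e 3) * θ + algebraMap F K (e 2) ≠ 0 := by
    intro h
    obtain ⟨-, h1, h0⟩ := indep 0 (e 3) (e 2) (by rw [map_zero]; linear_combination h)
    exact he23 ⟨h0, h1⟩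
  have hdet : -e 1 * e 2 - e 3 * -e 0 ≠ 0 := by
    intro h
    by_cases h3 : e 3 = 0
    · have h2 : e 2 ≠ 0 := fun h2 => he23 ⟨h2, h3⟩
      have h1 : e 1 = 0 := by
        have : e 1 * e 2 = 0 := by linear_combination -h + e 0 * h3
        simpa [h2] using this
      refine not_base (-(e 0 / e 2)) ?_
      have h2' : algebraMap F K (e 2) ≠ 0 := by simpa
      rw [h1, h3] at he
      simp only [map_neg, map_div₀, map_zero] at he ⊢
      field_simp
      linear_combination he
    · refine not_base (-(e 1 / e 3)) ?_
      have h3' : algebraMap F K (e 3) ≠ 0 := by simpa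
      have h' := congrArg (algebraMap F K) h
      simp only [map_neg, map_sub, map_mul, map_zero] at h'
      have hlin := (mul_eq_zero.1 (show (algebraMap F K (e 3) * θ + algebraMap F K (e 2)) *
        (algebraMap F K (e 3) * t + algebraMap F K (e 1)) = 0 by
          linear_combination algebraMap F K (e 3) * he - h')).resolve_left hQ
      simp only [map_neg, map_div₀]
      field_simp
      linear_combination hlin
  have htQ : t * (algebraMap F K (e 3) * θ + algebraMap F K (e 2))
      = -(algebraMap F K (e 1) * θ + algebraMap F K (e 0)) := by linear_combination he
  set x : Fin 4 → F := ![a, b, c, d] with hx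
  set y := coeffAct !![-e 1, e 3; -e 0, e 2] x with hy
  have hxy : InOrbit x y := inOrbit_of_eq _ _ _ _ hdet fun i => rfl
  have hyθ : algebraMap F K (y 0) * θ ^ 3 + algebraMap F K (y 1) * θ ^ 2 + algebraMap F K (y 2) * θ
      + algebraMap F K (y 3) = 0 := by
    have : algebraMap F K (-e 1 * e 2 - e 3 * -e 0) ≠ 0 := (map_ne_zero _).2 hdet
    refine (mul_eq_zero.1 ?_).resolve_left this
    have hmul : ∀ i, (-e 1 * e 2 - e 3 * -e 0) * y i =
        ((-e 1 * e 2 - e 3 * -e 0) • y) i := fun i => rfl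
    have hz : ∀ z : F, (-e 1 * e 2 - e 3 * -e 0) * ((-e 1 * e 2 - e 3 * -e 0)⁻¹ * z) = z :=
      fun z => mul_inv_cancel_left₀ hdet z
    simp only [mul_add, ← mul_assoc, ← map_mul]
    simp only [hy, hx, coeffAct, det_fin_two_of, cons_val, of_apply, cons_val', cons_val_zero,
      cons_val_one, hz]
    simp only [map_add, map_mul, map_neg, map_pow, map_ofNat]
    set P := -(algebraMap F K (e 1) * θ + algebraMap F K (e 0)) with hP
    set Q := algebraMap F K (e 3) * θ + algebraMap F K (e 2) with hQd
    have : algebraMap F K a * P ^ 3 + algebraMap F K b * P ^ 2 * Q + algebraMap F K c * P * Q ^ 2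
        + algebraMap F K d * Q ^ 3 = 0 := by
      rw [← htQ]
      linear_combination Q ^ 3 * htg
    rw [hP, hQd] at this
    linear_combination this
  obtain ⟨h1, h2, h3⟩ := indep (y 1 - y 0 * a₃) (y 2 - y 0 * b₃) (y 3 - y 0 * c₃) (by
    simp only [map_sub, map_mul]
    linear_combination hyθ - algebraMap F K (y 0) * hθf)
  have hyr : y = y 0 • ![1, a₃, b₃, c₃] := by
    ext i
    fin_cases i
    · simp
    · simpa [sub_eq_zero] using h1
    · simpa [sub_eq_zero] using h2
    · simpa [sub_eq_zero] using h3
  have hy0 : y 0 ≠ 0 := by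
    intro h0
    rw [h0, zero_smul] at hyr
    rw [hyr] at hxy
    obtain ⟨m, hm⟩ := inOrbit_iff.1 hxy.symm
    have := congrFun hm 0
    simp [coeffAct, hx] at this
    exact ha this.symm
  refine (inOrbit_smul hy0 _).trans ?_
  rw [← hyr]
  exact hxy.symm

/-- Representatives of the six orbits. -/
def orbitRep (a₂ b₂ a₃ b₃ c₃ : F) : Fin 6 → Fin 4 → F :=
  ![![0,0,0,0], ![0,0,0,1], ![0,0,1,0], ![0,1,-1,0], ![0,1,a₂,b₂], ![1,a₃,b₃,c₃]]

theorem no_root_of_irreducible_quadratic {a₂ b₂ : F}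
    (h2 : Irreducible (Polynomial.X ^ 2 + Polynomial.C a₂ * Polynomial.X + Polynomial.C b₂ :
      Polynomial F)) {s t : F} (h : s ^ 2 + a₂ * s * t + b₂ * t ^ 2 = 0) : t = 0 := by
  by_contra ht
  refine h2.not_isRoot_of_natDegree_ne_one (x := s / t) ?_ ?_
  · have : (Polynomial.X ^ 2 + Polynomial.C a₂ * Polynomial.X + Polynomial.C b₂ :
      Polynomial F).natDegree = 2 := by compute_degree!
    omega
  · simp only [Polynomial.IsRoot, Polynomial.eval_add, Polynomial.eval_mul, Polynomial.eval_pow,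
      Polynomial.eval_X, Polynomial.eval_C]
    field_simp
    linear_combination h

theorem no_root_of_irreducible_cubic {a₃ b₃ c₃ : F}
    (h3 : Irreducible (Polynomial.X ^ 3 + Polynomial.C a₃ * Polynomial.X ^ 2 +
      Polynomial.C b₃ * Polynomial.X + Polynomial.C c₃ : Polynomial F)) {s t : F}
    (h : s ^ 3 + a₃ * s ^ 2 * t + b₃ * s * t ^ 2 + c₃ * t ^ 3 = 0) : s = 0 ∧ t = 0 := by
  have ht : t = 0 := by
    by_contra ht
    refine h3.not_isRoot_of_natDegree_ne_one (x := s / t) ?_ ?_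
    · have : (Polynomial.X ^ 3 + Polynomial.C a₃ * Polynomial.X ^ 2 +
        Polynomial.C b₃ * Polynomial.X + Polynomial.C c₃ : Polynomial F).natDegree = 3 := by
        compute_degree!
      omega
    · simp only [Polynomial.IsRoot, Polynomial.eval_add, Polynomial.eval_mul, Polynomial.eval_pow,
        Polynomial.eval_X, Polynomial.eval_C]
      field_simp
      linear_combination h
  subst ht
  exact ⟨by simpa using h, rfl⟩

theorem exists_inOrbit_of_root {a₂ b₂ : F} (a₃ b₃ c₃ : F)
    (h2 : Irreducible (Polynomial.X ^ 2 + Polynomial.C a₂ * Polynomial.X + Polynomial.C b₂ :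
      Polynomial F)) (b c d : F) :
    ∃ j, InOrbit (orbitRep a₂ b₂ a₃ b₃ c₃ j) ![0, b, c, d] := by
  by_cases hb : b = 0
  · by_cases hc : c = 0
    · by_cases hd : d = 0
      · refine ⟨0, inOrbit_iff.2 ⟨1, ?_⟩⟩
        rw [Units.val_one, coeffAct_one]
        simp [orbitRep, hb, hc, hd]
      · refine ⟨1, ?_⟩
        simpa [orbitRep, hb, hc] using inOrbit_smul hd ![0, 0, 0, 1]
    · refine ⟨2, inOrbit_of_eq c 0 d c (by simpa) fun i => ?_⟩
      fin_cases i <;> simp [coeffAct, orbitRep, hb] <;> field_simp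
  · by_cases hs : ∃ s, b * s ^ 2 + c * s + d = 0
    · obtain ⟨s, hs⟩ := hs
      obtain rfl : d = -(b * s ^ 2 + c * s) := by linear_combination hs
      by_cases hm : c + 2 * b * s = 0
      · obtain rfl : c = -(2 * b * s) := by linear_combination hm
        refine ⟨2, inOrbit_of_eq 0 (-b) 1 (b * s) (by simpa) fun i => ?_⟩
        fin_cases i <;> simp [coeffAct, orbitRep] <;> field_simp <;> ring
      · obtain ⟨m, rfl⟩ : ∃ m, c = m - 2 * b * s := ⟨c + 2 * b * s, by ring⟩
        rw [sub_add_cancel] at hm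
        refine ⟨3, inOrbit_of_eq 0 b (-m) (-(b * s)) (by simp [hb, hm]) fun i => ?_⟩
        fin_cases i <;> simp [coeffAct, orbitRep] <;> field_simp <;> ring
    · push Not at hs
      exact ⟨4, inOrbit_irreducible_quadratic h2 hb hs⟩

theorem exists_inOrbit {a₂ b₂ a₃ b₃ c₃ : F}
    (h2 : Irreducible (Polynomial.X ^ 2 + Polynomial.C a₂ * Polynomial.X + Polynomial.C b₂ :
      Polynomial F))
    (h3 : Irreducible (Polynomial.X ^ 3 + Polynomial.C a₃ * Polynomial.X ^ 2 +
      Polynomial.C b₃ * Polynomial.X + Polynomial.C c₃ : Polynomial F)) (x : Fin 4 → F) :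
    ∃ j, InOrbit (orbitRep a₂ b₂ a₃ b₃ c₃ j) x := by
  by_cases hroot : ∃ a b c d, a * d - b * c ≠ 0 ∧
      x 0 * a ^ 3 + x 1 * a ^ 2 * b + x 2 * a * b ^ 2 + x 3 * b ^ 3 = 0
  · obtain ⟨a, b, c, d, hdet, h⟩ := hroot
    set y := coeffAct !![a, b; c, d] x with hy
    have hxy : InOrbit x y := inOrbit_of_eq a b c d hdet fun i => rfl
    have hy0 : y = ![0, y 1, y 2, y 3] := by
      ext i
      fin_cases i <;> simp
      simp [hy, coeffAct, h]
    obtain ⟨j, hj⟩ := exists_inOrbit_of_root a₃ b₃ c₃ h2 (y 1) (y 2) (y 3)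
    rw [← hy0] at hj
    exact ⟨j, hj.trans hxy.symm⟩
  · push Not at hroot
    refine ⟨5, ?_⟩
    have hx : x = ![x 0, x 1, x 2, x 3] := by
      ext i
      fin_cases i <;> rfl
    rw [hx]
    refine inOrbit_irreducible_cubic h3 ?_ fun s => ?_
    · simpa using hroot 1 0 0 1 (by simp)
    · simpa using hroot s 1 (-1) 0 (by simp)

/-- `GL₂(F)` as pairs of rows with nonvanishing determinant. -/
theorem vanishCount_eq_card_rows (S : Finset (Fin 4)) (x : Fin 4 → F) :
    vanishCount S x = Finset.card {v : (F × F) × (F × F) | v.1.1 * v.2.2 - v.1.2 * v.2.1 ≠ 0 ∧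
      ∀ i ∈ S, coeffAct !![v.1.1, v.1.2; v.2.1, v.2.2] x i = 0} := by
  refine Finset.card_bij (fun g _ => ((g 0 0, g 0 1), (g 1 0, g 1 1))) ?_ ?_ ?_
  · intro g hg
    have hdet : (g : Matrix (Fin 2) (Fin 2) F).det ≠ 0 := by
      rw [← isUnit_iff_ne_zero]
      exact (isUnit_iff_isUnit_det _).1 g.isUnit
    rw [det_fin_two] at hdet
    simp only [Finset.mem_filter, Finset.mem_univ, true_and] at hg ⊢
    rw [← eta_fin_two]
    exact ⟨hdet, hg⟩
  · intro g _ h _ hgh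
    simp only [Prod.mk.injEq] at hgh
    ext i j
    fin_cases i <;> fin_cases j <;> simp [hgh]
  · rintro ⟨⟨a, b⟩, ⟨c, d⟩⟩ hv
    simp only [Finset.mem_filter, Finset.mem_univ, true_and] at hv
    refine ⟨GeneralLinearGroup.mkOfDetNeZero !![a, b; c, d] (by rw [det_fin_two_of]; exact hv.1),
      by simpa [GeneralLinearGroup.mkOfDetNeZero] using hv.2, by simp [GeneralLinearGroup.mkOfDetNeZero]⟩

theorem vanishCount_congr {S T : Finset (Fin 4)} {x y : Fin 4 → F}
    (h : ∀ a b c d : F, a * d - b * c ≠ 0 → ((∀ i ∈ S, coeffAct !![a, b; c, d] x i = 0) ↔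
      ∀ i ∈ T, coeffAct !![a, b; c, d] y i = 0)) : vanishCount S x = vanishCount T y := by
  rw [vanishCount_eq_card_rows, vanishCount_eq_card_rows]
  congr 1
  ext v
  simp only [Finset.mem_filter, Finset.mem_univ, true_and, and_congr_right_iff]
  exact h _ _ _ _

theorem vanishCount_eq_zero {S : Finset (Fin 4)} {x : Fin 4 → F}
    (h : ∀ a b c d : F, a * d - b * c ≠ 0 → ¬ ∀ i ∈ S, coeffAct !![a, b; c, d] x i = 0) :
    vanishCount S x = 0 := by
  rw [vanishCount_eq_card_rows, Finset.card_eq_zero, Finset.filter_eq_empty_iff]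
  rintro v - ⟨h1, h2⟩
  exact h _ _ _ _ h1 h2

theorem exists_of_vanishCount_ne_zero {S : Finset (Fin 4)} {x : Fin 4 → F}
    (h : vanishCount S x ≠ 0) :
    ∃ a b c d : F, a * d - b * c ≠ 0 ∧ ∀ i ∈ S, coeffAct !![a, b; c, d] x i = 0 := by
  contrapose! h
  refine vanishCount_eq_zero fun a b c d hdet h' => ?_
  obtain ⟨i, hi, hne⟩ := h a b c d hdet
  exact hne (h' i hi)

theorem card_parallel {w : F × F} (hw : w ≠ 0) :
    Finset.card {w' : F × F | w.1 * w'.2 - w.2 * w'.1 = 0} = Fintype.card F := by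
  symm
  refine Finset.card_bij (fun c _ => (c * w.1, c * w.2)) ?_ ?_ ?_
  · intro c _
    simp only [Finset.mem_filter, Finset.mem_univ, true_and]
    ring
  · intro c _ d _ h
    simp only [Prod.mk.injEq, mul_eq_mul_right_iff] at h
    by_contra hcd
    exact hw (Prod.ext (h.1.resolve_left hcd) (h.2.resolve_left hcd))
  · rintro ⟨a, b⟩ h
    simp only [Finset.mem_filter, Finset.mem_univ, true_and] at h
    by_cases h1 : w.1 = 0
    · have h2 : w.2 ≠ 0 := fun h2 => hw (Prod.ext h1 h2)
      rw [h1] at h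
      have ha : a = 0 := by simpa [h2] using h
      exact ⟨b / w.2, Finset.mem_univ _, by simp [h1, h2, ha]⟩
    · refine ⟨a / w.1, Finset.mem_univ _, Prod.ext (by simp [h1]) ?_⟩
      simp only
      field_simp
      linear_combination -h

theorem card_parallel_ne_zero {w : F × F} (hw : w ≠ 0) :
    Finset.card {w' : F × F | w' ≠ 0 ∧ w.1 * w'.2 - w.2 * w'.1 = 0} = Fintype.card F - 1 := by
  rw [← card_parallel hw, ← Finset.card_erase_of_mem (a := (0 : F × F)) (by simp)]
  congr 1
  ext w'
  simp

theorem card_not_parallel {w : F × F} (hw : w ≠ 0) :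
    Finset.card {w' : F × F | w.1 * w'.2 - w.2 * w'.1 ≠ 0}
      = Fintype.card F ^ 2 - Fintype.card F := by
  have := Finset.card_filter_add_card_filter_not (s := (Finset.univ : Finset (F × F)))
    (fun w' => w.1 * w'.2 - w.2 * w'.1 = 0)
  rw [card_parallel hw, Finset.card_univ, Fintype.card_prod, ← sq] at this
  simp only [ne_eq]
  omega

/-- The number of nonzero vectors at which the form `x` vanishes. -/
def rootCount (x : Fin 4 → F) : ℕ :=
  Finset.card {w : F × F | w ≠ 0 ∧
    x 0 * w.1 ^ 3 + x 1 * w.1 ^ 2 * w.2 + x 2 * w.1 * w.2 ^ 2 + x 3 * w.2 ^ 3 = 0}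

theorem card_rows_first (P : F × F → Prop) :
    Finset.card {v : (F × F) × (F × F) | v.1.1 * v.2.2 - v.1.2 * v.2.1 ≠ 0 ∧ P v.1}
      = (Fintype.card F ^ 2 - Fintype.card F) * Finset.card {w : F × F | w ≠ 0 ∧ P w} := by
  rw [Finset.card_filter, Fintype.sum_prod_type, Finset.card_filter, Finset.mul_sum]
  refine Finset.sum_congr rfl fun w _ => ?_
  rw [← Finset.card_filter]
  by_cases hP : P w
  · by_cases hw : w = 0
    · simp [hw]
    · simp only [hP, and_true, ne_eq, hw, not_false_eq_true, if_true, mul_one]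
      exact card_not_parallel hw
  · simp [hP]

theorem card_rows_both {P : F × F → Prop} (hP : ∀ w w' : F × F, w ≠ 0 → P w →
      w.1 * w'.2 - w.2 * w'.1 = 0 → P w') :
    Finset.card {v : (F × F) × (F × F) | v.1.1 * v.2.2 - v.1.2 * v.2.1 ≠ 0 ∧ P v.1 ∧ P v.2}
        + Finset.card {w : F × F | w ≠ 0 ∧ P w} * (Fintype.card F - 1)
      = Finset.card {w : F × F | w ≠ 0 ∧ P w} ^ 2 := by
  set R : Finset (F × F) := {w : F × F | w ≠ 0 ∧ P w} with hR
  have hpar : ((R ×ˢ R).filter fun v => v.1.1 * v.2.2 - v.1.2 * v.2.1 = 0).card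
      = R.card * (Fintype.card F - 1) := by
    rw [Finset.card_filter, Finset.sum_product, ← smul_eq_mul, ← Finset.sum_const]
    refine Finset.sum_congr rfl fun w hw => ?_
    simp only [hR, Finset.mem_filter, Finset.mem_univ, true_and] at hw
    rw [← Finset.card_filter, ← card_parallel_ne_zero hw.1]
    congr 1
    ext w'
    simp only [hR, Finset.mem_filter, Finset.mem_univ, true_and]
    exact ⟨fun h => ⟨h.1.1, h.2⟩, fun h => ⟨⟨h.1, hP w w' hw.1 hw.2 h.2⟩, h.2⟩⟩
  have := Finset.card_filter_add_card_filter_not (s := R ×ˢ R)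
    (fun v => v.1.1 * v.2.2 - v.1.2 * v.2.1 = 0)
  rw [hpar, Finset.card_product, ← sq] at this
  rw [← this, add_comm]
  congr 2
  ext v
  simp only [hR, Finset.mem_filter, Finset.mem_univ, true_and, Finset.mem_product]
  constructor
  · rintro ⟨h, h1, h2⟩
    refine ⟨⟨⟨?_, h1⟩, ⟨?_, h2⟩⟩, h⟩ <;> intro h0 <;> simp [h0] at h
  · rintro ⟨⟨⟨-, h1⟩, ⟨-, h2⟩⟩, h⟩
    exact ⟨h, h1, h2⟩

theorem vanishCount_zero (x : Fin 4 → F) :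
    vanishCount {0} x = (Fintype.card F ^ 2 - Fintype.card F) * rootCount x := by
  rw [rootCount, ← card_rows_first, vanishCount_eq_card_rows]
  congr 1
  ext v
  simp only [Finset.mem_filter, Finset.mem_univ, true_and, Finset.mem_singleton, forall_eq]
  refine and_congr_right fun h => ?_
  simp [coeffAct, h]

theorem vanishCount_zero_three (x : Fin 4 → F) :
    vanishCount {0, 3} x + rootCount x * (Fintype.card F - 1) = rootCount x ^ 2 := by
  rw [rootCount, ← card_rows_both, vanishCount_eq_card_rows]
  · congr 2
    ext v
    simp only [Finset.mem_filter, Finset.mem_univ, true_and, Finset.mem_singleton, forall_eq,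
      Finset.mem_insert, forall_eq_or_imp]
    refine and_congr_right fun h => ?_
    simp [coeffAct, h]
  · intro w w' hw h hpar
    by_cases h1 : w.1 = 0
    · have h2 : w.2 ≠ 0 := fun h2 => hw (Prod.ext h1 h2)
      have h3 : w'.1 = 0 := by simpa [h1, h2] using hpar
      have h4 : x 3 = 0 := by simpa [h1, h2] using h
      simp [h3, h4]
    · refine mul_left_cancel₀ (pow_ne_zero 3 h1) ?_
      rw [mul_zero]
      have hp : w.1 * w'.2 = w.2 * w'.1 := by linear_combination hpar
      calc _ = x 0 * w.1 ^ 3 * w'.1 ^ 3 + x 1 * w.1 ^ 2 * w'.1 ^ 2 * (w.1 * w'.2)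
            + x 2 * w.1 * w'.1 * (w.1 * w'.2) ^ 2 + x 3 * (w.1 * w'.2) ^ 3 := by ring
        _ = 0 := by rw [hp]; linear_combination w'.1 ^ 3 * h

theorem vanishCount_rev (S : Finset (Fin 4)) (x : Fin 4 → F) :
    vanishCount (S.image Fin.rev) x = vanishCount S x := by
  let w : GeneralLinearGroup (Fin 2) F :=
    GeneralLinearGroup.mkOfDetNeZero !![0, 1; 1, 0] (by simp)
  refine Finset.card_equiv (Equiv.mulLeft w) fun g => ?_
  simp only [Finset.mem_filter, Finset.mem_univ, true_and, Finset.forall_mem_image,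
    Equiv.coe_mulLeft, Units.val_mul, coeffAct_mul]
  have : ∀ (y : Fin 4 → F) i, coeffAct (w : Matrix (Fin 2) (Fin 2) F) y i = - y i.rev := by
    intro y i
    fin_cases i <;> simp [coeffAct, w, GeneralLinearGroup.mkOfDetNeZero, Fin.rev]
  simp [this]

theorem card_generalLinearGroup : Fintype.card (GeneralLinearGroup (Fin 2) F)
    = (Fintype.card F ^ 2 - 1) * (Fintype.card F ^ 2 - Fintype.card F) := by
  rw [← Nat.card_eq_fintype_card, card_GL_field, Fin.prod_univ_two]
  simp

theorem vanishCount_empty (x : Fin 4 → F) : vanishCount ∅ x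
    = (Fintype.card F ^ 2 - 1) * (Fintype.card F ^ 2 - Fintype.card F) := by
  rw [← card_generalLinearGroup]
  simp [vanishCount]

theorem vanishCount_zero_form (S : Finset (Fin 4)) : vanishCount S ![0, 0, 0, (0 : F)]
    = (Fintype.card F ^ 2 - 1) * (Fintype.card F ^ 2 - Fintype.card F) := by
  rw [← vanishCount_empty ![0, 0, 0, (0 : F)]]
  refine vanishCount_congr fun a b c d _ => ?_
  have : ∀ i, coeffAct !![a, b; c, d] ![0, 0, 0, (0 : F)] i = 0 := by
    intro i
    fin_cases i <;> simp [coeffAct]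
  simp [this]

theorem vanishCount_univ {x : Fin 4 → F} (hx : x ≠ 0) : vanishCount Finset.univ x = 0 := by
  rw [vanishCount, Finset.card_eq_zero, Finset.filter_eq_empty_iff]
  intro g _ h
  have hg : coeffAct g x = coeffAct g 0 := by
    funext i
    rw [h i (Finset.mem_univ i)]
    fin_cases i <;> simp [coeffAct]
  exact hx ((coeffActEquiv g).injective hg)

theorem rootCount_zero_form : rootCount ![0, 0, 0, (0 : F)] = Fintype.card F ^ 2 - 1 := by
  simp [rootCount, Finset.filter_ne', sq]

theorem rootCount_cube : rootCount ![0, 0, 0, (1 : F)] = Fintype.card F - 1 := by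
  rw [rootCount, ← card_parallel_ne_zero (w := (1, 0)) (by simp)]
  simp

theorem rootCount_double : rootCount ![0, 0, 1, (0 : F)] = 2 * (Fintype.card F - 1) := by
  have h1 := card_parallel_ne_zero (F := F) (w := (1, 0)) (by simp)
  have h2 := card_parallel_ne_zero (F := F) (w := (0, 1)) (by simp)
  rw [two_mul]
  nth_rw 1 [← h1]
  rw [← h2, rootCount, ← Finset.card_union_of_disjoint]
  · congr 1
    ext ⟨s, t⟩
    simp
    tauto
  · rw [Finset.disjoint_left]
    rintro ⟨s, t⟩
    simp
    tauto

theorem rootCount_split : rootCount ![0, 1, -1, (0 : F)] = 3 * (Fintype.card F - 1) := by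
  have h1 := card_parallel_ne_zero (F := F) (w := (1, 1)) (by simp)
  have h2 := rootCount_double (F := F)
  rw [show 3 * (Fintype.card F - 1) = 2 * (Fintype.card F - 1) + (Fintype.card F - 1) by ring,
    ← h2]
  nth_rw 1 [← h1]
  rw [rootCount, rootCount, ← Finset.card_union_of_disjoint]
  · congr 1
    ext ⟨s, t⟩
    have : s ^ 2 * t + -(s * t ^ 2) = s * t * (s - t) := by ring
    simp [this, sub_eq_zero, eq_comm (a := s) (b := t)]
    tauto
  · rw [Finset.disjoint_left]
    rintro ⟨s, t⟩
    simp only [Finset.mem_filter, Finset.mem_univ, true_and, cons_val, one_mul, zero_mul, zero_add,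
      add_zero, mul_eq_zero, not_and, sub_eq_zero]
    rintro ⟨h0, h⟩ - rfl
    rcases h with rfl | h
    · exact h0 rfl
    · exact h0 (by simpa using h)

theorem rootCount_irreducible_quadratic {a₂ b₂ : F}
    (h2 : Irreducible (Polynomial.X ^ 2 + Polynomial.C a₂ * Polynomial.X + Polynomial.C b₂ :
      Polynomial F)) : rootCount ![0, 1, a₂, b₂] = Fintype.card F - 1 := by
  rw [rootCount, ← card_parallel_ne_zero (w := (1, 0)) (by simp)]
  congr 1
  ext ⟨s, t⟩
  simp only [Finset.mem_filter, Finset.mem_univ, true_and, cons_val, and_congr_right_iff, one_mul,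
    zero_mul, zero_add, sub_zero]
  refine fun _ => ⟨fun h => ?_, fun h => by simp [h]⟩
  have h' : t * (s ^ 2 + a₂ * s * t + b₂ * t ^ 2) = 0 := by linear_combination h
  rcases mul_eq_zero.1 h' with h' | h'
  · exact h'
  · exact no_root_of_irreducible_quadratic h2 h'

theorem rootCount_irreducible_cubic {a₃ b₃ c₃ : F}
    (h3 : Irreducible (Polynomial.X ^ 3 + Polynomial.C a₃ * Polynomial.X ^ 2 +
      Polynomial.C b₃ * Polynomial.X + Polynomial.C c₃ : Polynomial F)) :
    rootCount ![1, a₃, b₃, c₃] = 0 := by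
  rw [rootCount, Finset.card_eq_zero, Finset.filter_eq_empty_iff]
  rintro ⟨s, t⟩ - ⟨h0, h⟩
  obtain ⟨rfl, rfl⟩ := no_root_of_irreducible_cubic h3 (s := s) (t := t) (by simpa using h)
  exact h0 rfl

theorem vanishCount_eq_first {S : Finset (Fin 4)} {x : Fin 4 → F}
    (h : ∀ a b c d : F, a * d - b * c ≠ 0 →
      ((∀ i ∈ S, coeffAct !![a, b; c, d] x i = 0) ↔ b = 0)) :
    vanishCount S x = (Fintype.card F ^ 2 - Fintype.card F) * (Fintype.card F - 1) := by
  rw [← rootCount_cube (F := F), ← vanishCount_zero]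
  refine vanishCount_congr fun a b c d hdet => ?_
  rw [h a b c d hdet]
  simp [coeffAct, hdet]

theorem vanishCount_zero_one_cube : vanishCount {0, 1} ![0, 0, 0, (1 : F)]
    = (Fintype.card F ^ 2 - Fintype.card F) * (Fintype.card F - 1) := by
  refine vanishCount_eq_first fun a b c d hdet => ?_
  simp [coeffAct, hdet]
  tauto

theorem vanishCount_zero_one_two_cube : vanishCount {0, 1, 2} ![0, 0, 0, (1 : F)]
    = (Fintype.card F ^ 2 - Fintype.card F) * (Fintype.card F - 1) := by
  refine vanishCount_eq_first fun a b c d hdet => ?_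
  simp [coeffAct, hdet]
  tauto

theorem vanishCount_zero_one_double : vanishCount {0, 1} ![0, 0, 1, (0 : F)]
    = (Fintype.card F ^ 2 - Fintype.card F) * (Fintype.card F - 1) := by
  refine vanishCount_eq_first fun a b c d hdet => ?_
  simp only [Finset.mem_insert, Finset.mem_singleton, forall_eq_or_imp, forall_eq, coeffAct,
    det_fin_two_of, cons_val, of_apply, cons_val', mul_eq_zero, inv_eq_zero, hdet, false_or]
  constructor
  · rintro ⟨h1, h2⟩
    by_contra hb
    have ha : a = 0 := by simpa [hb] using h1
    have hc : c = 0 := by simpa [ha, hb] using h2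
    simp [ha, hc] at hdet
  · rintro rfl
    simp

theorem vanishCount_zero_one_two_double : vanishCount {0, 1, 2} ![0, 0, 1, (0 : F)] = 0 := by
  refine vanishCount_eq_zero fun a b c d hdet => ?_
  simp only [Finset.mem_insert, Finset.mem_singleton, forall_eq_or_imp, forall_eq, coeffAct,
    det_fin_two_of, cons_val, of_apply, cons_val', mul_eq_zero, inv_eq_zero, hdet, false_or]
  rintro ⟨h1, h2, h3⟩
  by_cases hb : b = 0
  · subst hb
    have : a = 0 ∨ d = 0 := by simpa using h3
    rcases this with rfl | rfl <;> simp at hdet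
  · have ha : a = 0 := by simpa [hb] using h1
    have hc : c = 0 := by simpa [ha, hb] using h2
    simp [ha, hc] at hdet

theorem vanishCount_zero_one_split : vanishCount {0, 1} ![0, 1, -1, (0 : F)] = 0 := by
  refine vanishCount_eq_zero fun a b c d hdet => ?_
  simp only [Finset.mem_insert, Finset.mem_singleton, forall_eq_or_imp, forall_eq, coeffAct,
    det_fin_two_of, cons_val, of_apply, cons_val', mul_eq_zero, inv_eq_zero, hdet, false_or]
  rintro ⟨h1, h2⟩
  have h1' : a * b * (a - b) = 0 := by linear_combination h1
  rcases mul_eq_zero.1 h1' with h | h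
  · rcases mul_eq_zero.1 h with rfl | rfl
    · have : c = 0 ∨ b = 0 := by simpa using h2
      rcases this with rfl | rfl <;> simp at hdet
    · have : a = 0 ∨ d = 0 := by simpa using h2
      rcases this with rfl | rfl <;> simp at hdet
  · obtain rfl : a = b := sub_eq_zero.1 h
    have : a * (a * d - a * c) = 0 := by linear_combination -h2
    rcases mul_eq_zero.1 this with rfl | h
    · simp at hdet
    · exact hdet h

theorem vanishCount_zero_one_irreducible_quadratic {a₂ b₂ : F}
    (hi : Irreducible (Polynomial.X ^ 2 + Polynomial.C a₂ * Polynomial.X + Polynomial.C b₂ :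
      Polynomial F)) : vanishCount {0, 1} ![0, 1, a₂, b₂] = 0 := by
  refine vanishCount_eq_zero fun a b c d hdet => ?_
  simp only [Finset.mem_insert, Finset.mem_singleton, forall_eq_or_imp, forall_eq, coeffAct,
    det_fin_two_of, cons_val, of_apply, cons_val', mul_eq_zero, inv_eq_zero, hdet, false_or]
  rintro ⟨h1, h2⟩
  have h1' : b * (a ^ 2 + a₂ * a * b + b₂ * b ^ 2) = 0 := by linear_combination h1
  have hb : b = 0 := (mul_eq_zero.1 h1').elim id (no_root_of_irreducible_quadratic hi)
  subst hb
  have : a = 0 ∨ d = 0 := by simpa using h2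
  rcases this with rfl | rfl <;> simp at hdet

theorem vanishCount_mono {S T : Finset (Fin 4)} (hST : S ⊆ T) (x : Fin 4 → F) :
    vanishCount T x ≤ vanishCount S x :=
  Finset.card_le_card fun g hg => by
    simp only [Finset.mem_filter, Finset.mem_univ, true_and] at hg ⊢
    exact fun i hi => hg i (hST hi)

theorem vanishCount_one_two_cube (h3 : (3 : F) ≠ 0) : vanishCount {1, 2} ![0, 0, 0, (1 : F)]
    = 2 * ((Fintype.card F ^ 2 - Fintype.card F) * (Fintype.card F - 1)) := by
  have h1 := vanishCount_zero_one_two_cube (F := F)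
  have h2 := (vanishCount_rev {0, 1, 2} _).trans h1
  rw [two_mul]
  nth_rw 1 [← h2]
  rw [← h1, vanishCount_eq_card_rows, vanishCount_eq_card_rows, vanishCount_eq_card_rows,
    ← Finset.card_union_of_disjoint]
  · congr 1
    ext ⟨⟨a, b⟩, ⟨c, d⟩⟩
    simp only [Finset.mem_union, Finset.mem_filter, Finset.mem_univ, true_and, ← and_or_left]
    refine and_congr_right fun hdet => ?_
    simp [coeffAct, hdet, h3, Fin.rev]
    tauto
  · rw [Finset.disjoint_left]
    rintro ⟨⟨a, b⟩, ⟨c, d⟩⟩ h h'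
    simp only [Finset.mem_filter, Finset.mem_univ, true_and] at h h'
    obtain ⟨hdet, h⟩ := h
    replace h' := h'.2
    simp [coeffAct, hdet, h3, Fin.rev] at h h'
    rw [h.1, h'.1] at hdet
    simp at hdet

theorem vanishCount_one_two_double (h3 : (3 : F) ≠ 0) :
    vanishCount {1, 2} ![0, 0, 1, (0 : F)] = 0 := by
  refine vanishCount_eq_zero fun a b c d hdet => ?_
  simp only [Finset.mem_insert, Finset.mem_singleton, forall_eq_or_imp, forall_eq, coeffAct,
    det_fin_two_of, cons_val, of_apply, cons_val', mul_eq_zero, inv_eq_zero, hdet, false_or]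
  rintro ⟨h1, h2⟩
  by_cases hb : b = 0
  · subst hb
    have : a = 0 ∨ d = 0 := by simpa using h2
    rcases this with rfl | rfl <;> simp at hdet
  by_cases hd : d = 0
  · subst hd
    have : c = 0 ∨ b = 0 := by simpa using h1
    rcases this with rfl | rfl <;> simp at hdet
  have h1' : c * b + 2 * a * d = 0 := mul_left_cancel₀ hb (by linear_combination h1)
  have h2' : a * d + 2 * c * b = 0 := mul_left_cancel₀ hd (by linear_combination h2)
  have h3' : 3 * (a * d) = 0 := by linear_combination 2 * h1' - h2'
  have h4 : 3 * (c * b) = 0 := by linear_combination 2 * h2' - h1'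
  have h5 := (mul_eq_zero.1 h3').resolve_left h3
  have h6 := (mul_eq_zero.1 h4).resolve_left h3
  exact hdet (by linear_combination h5 - h6)

theorem exists_inOrbit_of_vanishCount_ne_zero {S : Finset (Fin 4)} {x : Fin 4 → F}
    (h : vanishCount S x ≠ 0) : ∃ y, InOrbit x y ∧ ∀ i ∈ S, y i = 0 := by
  obtain ⟨a, b, c, d, hdet, h⟩ := exists_of_vanishCount_ne_zero h
  exact ⟨_, inOrbit_of_eq a b c d hdet fun _ => rfl, h⟩

theorem vanishCount_ne_zero_of_inOrbit {S : Finset (Fin 4)} {x y : Fin 4 → F}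
    (h : InOrbit x y) (hy : ∀ i ∈ S, y i = 0) : vanishCount S x ≠ 0 := by
  obtain ⟨g, rfl⟩ := inOrbit_iff.1 h
  exact Finset.card_ne_zero.2 ⟨g, by simpa using hy⟩

theorem exists_diagonal_form {x : Fin 4 → F} (h01 : vanishCount {0, 1} x = 0)
    (h12 : vanishCount {1, 2} x ≠ 0) : ∃ a d : F, a ≠ 0 ∧ d ≠ 0 ∧ InOrbit x ![a, 0, 0, d] := by
  obtain ⟨y, hxy, hy⟩ := exists_inOrbit_of_vanishCount_ne_zero h12
  have hy1 : y 1 = 0 := hy 1 (by simp)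
  have hy2 : y 2 = 0 := hy 2 (by simp)
  refine ⟨y 0, y 3, fun h => ?_, fun h => ?_, ?_⟩
  · exact vanishCount_ne_zero_of_inOrbit hxy (by simp [h, hy1]) h01
  · rw [← vanishCount_rev] at h01
    exact vanishCount_ne_zero_of_inOrbit hxy (by simp [Fin.rev, h, hy2]) h01
  · convert hxy
    ext i
    fin_cases i <;> simp [hy1, hy2]

theorem vanishCount_one_two_split_of_cube_root {ω : F} (hω : ω ^ 2 + ω + 1 = 0)
    (h3 : (3 : F) ≠ 0) :
    vanishCount {1, 2} ![0, 1, -1, (0 : F)] = vanishCount {0, 3} ![0, 0, 1, (0 : F)] := by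
  have horb : InOrbit ![0, 1, -1, (0 : F)] ![1, 0, 0, -1] := by
    have hk : (1 + 2 * ω) ^ 2 = -3 := by linear_combination 4 * hω
    have hk0 : 1 + 2 * ω ≠ 0 := by
      intro h
      rw [h] at hk
      exact h3 (by linear_combination hk)
    have hdet : (-1 - 2 * ω) * (ω - 1) - (-ω - 2) * (1 + 2 * ω) = 3 * (1 + 2 * ω) := by ring
    have hne : 3 * (1 + 2 * ω) ≠ 0 := mul_ne_zero h3 hk0
    refine inOrbit_of_eq (-1 - 2 * ω) (-ω - 2) (1 + 2 * ω) (ω - 1) (by rwa [hdet]) fun i => ?_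
    fin_cases i <;>
    · simp only [coeffAct, det_fin_two_of, hdet, cons_val, of_apply, cons_val', Fin.zero_eta,
        Fin.mk_one, Fin.reduceFinMk]
      rw [inv_mul_eq_iff_eq_mul₀ hne]
      grind
  rw [← vanishCount_eq_of_inOrbit _ horb]
  refine vanishCount_congr fun a b c d hdet => ?_
  simp only [Finset.mem_insert, Finset.mem_singleton, forall_eq_or_imp, forall_eq, coeffAct,
    det_fin_two_of, cons_val, of_apply, cons_val', mul_eq_zero, inv_eq_zero, hdet, false_or]
  constructor
  · rintro ⟨h1, h2⟩
    have h1' : a ^ 2 * c = b ^ 2 * d := mul_left_cancel₀ h3 (by linear_combination h1)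
    have h2' : a * c ^ 2 = b * d ^ 2 := mul_left_cancel₀ h3 (by linear_combination h2)
    have h4 : b * d * (a * d - b * c) = 0 := by linear_combination c * h1' - a * h2'
    have h5 : a * c * (a * d - b * c) = 0 := by linear_combination d * h1' - b * h2'
    have h6 := (mul_eq_zero.1 h4).resolve_right hdet
    have h7 := (mul_eq_zero.1 h5).resolve_right hdet
    grind
  · rintro ⟨h1, h2⟩
    simp at h1 h2
    grind

theorem vanishCount_one_two_eq_zero_of_cube_root {ω : F} (hω : ω ^ 2 + ω + 1 = 0)
    (h3 : (3 : F) ≠ 0) {x : Fin 4 → F} (h0 : vanishCount {0} x ≠ 0)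
    (h01 : vanishCount {0, 1} x = 0) (h03 : vanishCount {0, 3} x = 0) :
    vanishCount {1, 2} x = 0 := by
  by_contra h12
  obtain ⟨a, d, ha, hd, h⟩ := exists_diagonal_form h01 h12
  rw [← vanishCount_eq_of_inOrbit _ h] at h0 h03
  obtain ⟨s, t, s', t', hdet, hz⟩ := exists_of_vanishCount_ne_zero h0
  have hst : a * s ^ 3 + d * t ^ 3 = 0 := by
    simpa [coeffAct, hdet] using hz
  have hs : s ≠ 0 := by
    rintro rfl
    simp [hd] at hst
    simp [hst] at hdet
  have ht : t ≠ 0 := by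
    rintro rfl
    simp [ha] at hst
    exact hs hst
  have hω1 : ω ≠ 1 := by
    rintro rfl
    exact h3 (by linear_combination hω)
  have hdet' : s * t - t * (ω * s) ≠ 0 := by
    rw [show s * t - t * (ω * s) = s * t * (1 - ω) by ring]
    exact mul_ne_zero (mul_ne_zero hs ht) (sub_ne_zero.2 hω1.symm)
  refine vanishCount_ne_zero_of_inOrbit
    (inOrbit_of_eq (r := ![a, 0, 0, d]) s t (ω * s) t hdet' fun _ => rfl) ?_ h03
  have : a * (ω * s) ^ 3 + d * t ^ 3 = 0 := by
    linear_combination hst + a * s ^ 3 * (ω - 1) * hω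
  simp [coeffAct, hst, this]

theorem vanishCount_one_two_eq_zero_of_injective (hinj : Function.Injective fun t : F => t ^ 3)
    {x : Fin 4 → F} (h01 : vanishCount {0, 1} x = 0) (h03 : vanishCount {0, 3} x ≠ 0) :
    vanishCount {1, 2} x = 0 := by
  by_contra h12
  obtain ⟨a, d, ha, hd, h⟩ := exists_diagonal_form h01 h12
  rw [← vanishCount_eq_of_inOrbit _ h] at h03
  obtain ⟨s, t, s', t', hdet, hz⟩ := exists_of_vanishCount_ne_zero h03
  have hst : a * s ^ 3 + d * t ^ 3 = 0 ∧ a * s' ^ 3 + d * t' ^ 3 = 0 := by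
    simpa [coeffAct, hdet] using hz
  refine hdet (sub_eq_zero.2 (hinj (mul_left_cancel₀ ha ?_)))
  linear_combination t' ^ 3 * hst.1 - t ^ 3 * hst.2

theorem vanishCount_one_two_eq_zero_of_surjective (hsurj : Function.Surjective fun t : F => t ^ 3)
    {x : Fin 4 → F} (h0 : vanishCount {0} x = 0) : vanishCount {1, 2} x = 0 := by
  by_contra h12
  obtain ⟨a, d, ha, hd, h⟩ := exists_diagonal_form
    (Nat.eq_zero_of_le_zero (h0 ▸ vanishCount_mono (by simp) x)) h12
  obtain ⟨s, hs⟩ := hsurj (-d / a)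
  refine vanishCount_ne_zero_of_inOrbit
    (h.trans (inOrbit_of_eq s 1 1 0 (by simp) fun _ => rfl)) ?_ h0
  have : a * s ^ 3 + d = 0 := by
    rw [show s ^ 3 = -d / a from hs]
    field_simp
    ring
  simp [coeffAct, this]

theorem exists_cube_root_of_one (hq : Fintype.card F % 3 = 1) : ∃ ω : F, ω ^ 2 + ω + 1 = 0 := by
  have hcard : 3 ∣ Fintype.card Fˣ := by
    rw [Fintype.card_units]
    omega
  have : Fact (Nat.Prime 3) := ⟨Nat.prime_three⟩
  obtain ⟨g, hg⟩ := exists_prime_orderOf_dvd_card 3 hcard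
  refine ⟨g, ?_⟩
  have h1 : (g : F) ≠ 1 := by
    intro h
    have : g = 1 := Units.ext h
    simp [this] at hg
  have h2 : (g : F) ^ 3 = 1 := by
    rw [← Units.val_pow_eq_pow_val, ← hg, pow_orderOf_eq_one, Units.val_one]
  exact mul_left_cancel₀ (sub_ne_zero.2 h1) (by linear_combination h2)

theorem bijective_cube (hq : Fintype.card F % 3 = 2) :
    Function.Bijective fun t : F => t ^ 3 := by
  refine Finite.injective_iff_bijective.1 fun s t hst => ?_
  have hcop : (Nat.card Fˣ).Coprime 3 := by
    rw [Nat.coprime_comm, Nat.Prime.coprime_iff_not_dvd Nat.prime_three, Nat.card_eq_fintype_card,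
      Fintype.card_units]
    omega
  replace hst : s ^ 3 = t ^ 3 := hst
  by_cases hs : s = 0
  · subst hs
    exact ((pow_eq_zero_iff (n := 3) (by simp)).1 (by simpa using hst.symm)).symm
  · have ht : t ≠ 0 := by
      rintro rfl
      exact hs ((pow_eq_zero_iff (n := 3) (by simp)).1 (by simpa using hst))
    have := (powCoprime hcop).injective (a₁ := Units.mk0 s hs) (a₂ := Units.mk0 t ht)
      (Units.ext (by simpa using hst))
    simpa using congrArg Units.val this

theorem sum_ite_inOrbit {ι : Type*} [Fintype ι] {r : ι → Fin 4 → F}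
    (hcover : ∀ x, ∃! j, InOrbit (r j) x) (S : Finset (Fin 4)) (x : Fin 4 → F) :
    (vanishCount S x : ℂ)
      = ∑ j, (vanishCount S (r j) : ℂ) * (if InOrbit (r j) x then 1 else 0) := by
  obtain ⟨j, hj, huniq⟩ := hcover x
  rw [Finset.sum_eq_single j, if_pos hj, mul_one, vanishCount_eq_of_inOrbit S hj]
  · intro k _ hk
    rw [if_neg fun h => hk (huniq k h), mul_zero]
  · simp

theorem sum_vanishCount_mul_orbitSum (p : ℕ) [Fact p.Prime] [CharP F p] (h3 : (3 : F) ≠ 0)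
    {ι : Type*} [Fintype ι] {r : ι → Fin 4 → F} (hcover : ∀ x, ∃! j, InOrbit (r j) x)
    (S : Finset (Fin 4)) (y : Fin 4 → F) :
    ∑ j, (vanishCount S (r j) : ℂ) *
        ∑ x, (if InOrbit (r j) x then 1 else 0) * psiF p F (bformBC x y)
      = (Fintype.card F : ℂ) ^ (Sᶜ).card * vanishCount Sᶜ y := by
  rw [← sum_vanishCount_mul_psiF p h3]
  simp_rw [Finset.mul_sum]
  rw [Finset.sum_comm]
  refine Finset.sum_congr rfl fun x _ => ?_
  rw [sum_ite_inOrbit hcover S x, Finset.sum_mul]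
  exact Finset.sum_congr rfl fun j _ => (mul_assoc _ _ _).symm

theorem rootCount_orbitRep {a₂ b₂ a₃ b₃ c₃ : F}
    (h2 : Irreducible (Polynomial.X ^ 2 + Polynomial.C a₂ * Polynomial.X + Polynomial.C b₂ :
      Polynomial F))
    (h3 : Irreducible (Polynomial.X ^ 3 + Polynomial.C a₃ * Polynomial.X ^ 2 +
      Polynomial.C b₃ * Polynomial.X + Polynomial.C c₃ : Polynomial F))
    (i : Fin 6) :
    rootCount (orbitRep a₂ b₂ a₃ b₃ c₃ i)
    = (Fintype.card F - 1) * ![Fintype.card F + 1, 1, 2, 3, 1, 0] i := by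
  fin_cases i
  · refine rootCount_zero_form.trans ?_
    simpa [mul_comm] using Nat.sq_sub_sq (Fintype.card F) 1
  · exact rootCount_cube.trans (mul_one _).symm
  · exact rootCount_double.trans (mul_comm _ _)
  · exact rootCount_split.trans (mul_comm _ _)
  · exact (rootCount_irreducible_quadratic h2).trans (mul_one _).symm
  · exact rootCount_irreducible_cubic h3

theorem vanishCount_zero_orbitRep {a₂ b₂ a₃ b₃ c₃ : F}
    (h2 : Irreducible (Polynomial.X ^ 2 + Polynomial.C a₂ * Polynomial.X + Polynomial.C b₂ :
      Polynomial F))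
    (h3 : Irreducible (Polynomial.X ^ 3 + Polynomial.C a₃ * Polynomial.X ^ 2 +
      Polynomial.C b₃ * Polynomial.X + Polynomial.C c₃ : Polynomial F))
    (i : Fin 6) :
    vanishCount {0} (orbitRep a₂ b₂ a₃ b₃ c₃ i)
      = (Fintype.card F ^ 2 - Fintype.card F) * (Fintype.card F - 1)
        * ![Fintype.card F + 1, 1, 2, 3, 1, 0] i := by
  rw [vanishCount_zero, rootCount_orbitRep h2 h3, mul_assoc]

theorem vanishCount_irreducible_cubic {a₃ b₃ c₃ : F}
    (h3 : Irreducible (Polynomial.X ^ 3 + Polynomial.C a₃ * Polynomial.X ^ 2 +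
      Polynomial.C b₃ * Polynomial.X + Polynomial.C c₃ : Polynomial F))
    {S : Finset (Fin 4)} (hS : 0 ∈ S) :
    vanishCount S ![1, a₃, b₃, c₃] = 0 := by
  refine Nat.eq_zero_of_le_zero ((vanishCount_mono (Finset.singleton_subset_iff.2 hS) _).trans ?_)
  rw [vanishCount_zero, rootCount_irreducible_cubic h3, mul_zero]

theorem card_sq_sub_one_mul : (Fintype.card F ^ 2 - 1) * (Fintype.card F ^ 2 - Fintype.card F)
    = (Fintype.card F ^ 2 - Fintype.card F) * (Fintype.card F - 1) * (Fintype.card F + 1) := by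
  have := Nat.sq_sub_sq (Fintype.card F) 1
  rw [one_pow] at this
  rw [this]
  ring

theorem vanishCount_zero_one_orbitRep {a₂ b₂ a₃ b₃ c₃ : F}
    (h2 : Irreducible (Polynomial.X ^ 2 + Polynomial.C a₂ * Polynomial.X + Polynomial.C b₂ :
      Polynomial F))
    (h3 : Irreducible (Polynomial.X ^ 3 + Polynomial.C a₃ * Polynomial.X ^ 2 +
      Polynomial.C b₃ * Polynomial.X + Polynomial.C c₃ : Polynomial F))
    (i : Fin 6) :
    vanishCount {0, 1} (orbitRep a₂ b₂ a₃ b₃ c₃ i)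
      = (Fintype.card F ^ 2 - Fintype.card F) * (Fintype.card F - 1)
        * ![Fintype.card F + 1, 1, 1, 0, 0, 0] i := by
  fin_cases i
  · exact (vanishCount_zero_form _).trans card_sq_sub_one_mul
  · exact vanishCount_zero_one_cube.trans (mul_one _).symm
  · exact vanishCount_zero_one_double.trans (mul_one _).symm
  · exact vanishCount_zero_one_split
  · exact vanishCount_zero_one_irreducible_quadratic h2
  · exact vanishCount_irreducible_cubic h3 (by simp)

theorem vanishCount_zero_one_two_orbitRep {a₂ b₂ a₃ b₃ c₃ : F}
    (h2 : Irreducible (Polynomial.X ^ 2 + Polynomial.C a₂ * Polynomial.X + Polynomial.C b₂ :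
      Polynomial F))
    (h3 : Irreducible (Polynomial.X ^ 3 + Polynomial.C a₃ * Polynomial.X ^ 2 +
      Polynomial.C b₃ * Polynomial.X + Polynomial.C c₃ : Polynomial F))
    (i : Fin 6) :
    vanishCount {0, 1, 2} (orbitRep a₂ b₂ a₃ b₃ c₃ i)
      = (Fintype.card F ^ 2 - Fintype.card F) * (Fintype.card F - 1)
        * ![Fintype.card F + 1, 1, 0, 0, 0, 0] i := by
  have hle : ∀ x : Fin 4 → F, vanishCount {0, 1} x = 0 → vanishCount {0, 1, 2} x = 0 :=
    fun x hx => Nat.eq_zero_of_le_zero (hx ▸ vanishCount_mono (by simp) x)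
  fin_cases i
  · exact (vanishCount_zero_form _).trans card_sq_sub_one_mul
  · exact vanishCount_zero_one_two_cube.trans (mul_one _).symm
  · exact vanishCount_zero_one_two_double
  · exact hle _ vanishCount_zero_one_split
  · exact hle _ (vanishCount_zero_one_irreducible_quadratic h2)
  · exact vanishCount_irreducible_cubic h3 (by simp)

theorem vanishCount_zero_three_orbitRep {a₂ b₂ a₃ b₃ c₃ : F}
    (h2 : Irreducible (Polynomial.X ^ 2 + Polynomial.C a₂ * Polynomial.X + Polynomial.C b₂ :
      Polynomial F))
    (h3 : Irreducible (Polynomial.X ^ 3 + Polynomial.C a₃ * Polynomial.X ^ 2 +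
      Polynomial.C b₃ * Polynomial.X + Polynomial.C c₃ : Polynomial F))
    (i : Fin 6) :
    vanishCount {0, 3} (orbitRep a₂ b₂ a₃ b₃ c₃ i)
      = (Fintype.card F - 1) ^ 2
        * ![Fintype.card F * (Fintype.card F + 1), 0, 2, 6, 0, 0] i := by
  have h := vanishCount_zero_three (orbitRep a₂ b₂ a₃ b₃ c₃ i)
  rw [rootCount_orbitRep h2 h3] at h
  refine Nat.add_right_cancel (h.trans ?_)
  fin_cases i <;> simp <;> ring

theorem vanishCount_univ_orbitRep {a₂ b₂ a₃ b₃ c₃ : F} (i : Fin 6) :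
    vanishCount Finset.univ (orbitRep a₂ b₂ a₃ b₃ c₃ i)
      = (Fintype.card F ^ 2 - Fintype.card F) * (Fintype.card F - 1)
        * ![Fintype.card F + 1, 0, 0, 0, 0, 0] i := by
  fin_cases i
  · exact (vanishCount_zero_form _).trans card_sq_sub_one_mul
  · exact vanishCount_univ fun h => by simpa [orbitRep] using congrFun h 3
  · exact vanishCount_univ fun h => by simpa [orbitRep] using congrFun h 2
  · exact vanishCount_univ fun h => by simpa [orbitRep] using congrFun h 1
  · exact vanishCount_univ fun h => by simpa [orbitRep] using congrFun h 1
  · exact vanishCount_univ fun h => by simpa [orbitRep] using congrFun h 0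

theorem existsUnique_inOrbit {a₂ b₂ a₃ b₃ c₃ : F}
    (h2 : Irreducible (Polynomial.X ^ 2 + Polynomial.C a₂ * Polynomial.X + Polynomial.C b₂ :
      Polynomial F))
    (h3 : Irreducible (Polynomial.X ^ 3 + Polynomial.C a₃ * Polynomial.X ^ 2 +
      Polynomial.C b₃ * Polynomial.X + Polynomial.C c₃ : Polynomial F))
    (x : Fin 4 → F) :
    ∃! j, InOrbit (orbitRep a₂ b₂ a₃ b₃ c₃ j) x := by
  obtain ⟨j, hj⟩ := exists_inOrbit h2 h3 x
  refine ⟨j, hj, fun k hk => ?_⟩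
  have hq : 1 < Fintype.card F := Fintype.one_lt_card
  have hK : 0 < (Fintype.card F ^ 2 - Fintype.card F) * (Fintype.card F - 1) :=
    Nat.mul_pos (Nat.sub_pos_of_lt (by nlinarith)) (by omega)
  have e1 := (vanishCount_eq_of_inOrbit {0} hj).symm.trans (vanishCount_eq_of_inOrbit {0} hk)
  have e2 := (vanishCount_eq_of_inOrbit {0, 1} hj).symm.trans
    (vanishCount_eq_of_inOrbit {0, 1} hk)
  rw [vanishCount_zero_orbitRep h2 h3, vanishCount_zero_orbitRep h2 h3] at e1
  rw [vanishCount_zero_one_orbitRep h2 h3, vanishCount_zero_one_orbitRep h2 h3] at e2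
  replace e1 := Nat.eq_of_mul_eq_mul_left hK e1
  replace e2 := Nat.eq_of_mul_eq_mul_left hK e2
  clear hj hk hK
  fin_cases j <;> fin_cases k <;> first | rfl | (simp at e1 e2; try omega)

theorem orbitSum_eq_of_relations {q n m w l z : ℂ} (h0 : q ≠ 0) (h1 : q - 1 ≠ 0) {t : Fin 6 → ℂ}
    (huniv : ∑ j, (q ^ 2 - q) * (q - 1) * ![q + 1, 0, 0, 0, 0, 0] j * t j
      = (q ^ 2 - q) * (q - 1) * (q + 1))
    (h012 : ∑ j, (q ^ 2 - q) * (q - 1) * ![q + 1, 1, 0, 0, 0, 0] j * t j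
      = q * ((q ^ 2 - q) * (q - 1) * n))
    (h01 : ∑ j, (q ^ 2 - q) * (q - 1) * ![q + 1, 1, 1, 0, 0, 0] j * t j
      = q ^ 2 * ((q ^ 2 - q) * (q - 1) * m))
    (h03 : ∑ j, (q - 1) ^ 2 * ![q * (q + 1), 0, 2, 6, 0, 0] j * t j = q ^ 2 * ((q - 1) ^ 2 * w))
    (hzero : ∑ j, (q ^ 2 - q) * (q - 1) * ![q + 1, 1, 2, 3, 1, 0] j * t j
      = q ^ 3 * ((q ^ 2 - q) * (q - 1) * l))
    (hempty : ∑ j, (q ^ 2 - q) * (q - 1) * (q + 1) * t j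
      = q ^ 4 * ((q ^ 2 - q) * (q - 1) * (q + 1) * z)) (hq : q + 1 ≠ 0) :
    t = ![1, q * n - (q + 1), q ^ 2 * m - q * n,
      (q ^ 2 * w - q * (q + 1) - 2 * (q ^ 2 * m - q * n)) / 6,
      q ^ 3 * l - q ^ 2 * m - (q ^ 2 * w - q * (q + 1) - 2 * (q ^ 2 * m - q * n)) / 2
        - (q ^ 2 * m - q * n),
      q ^ 4 * z + q - q ^ 3 * l
        + (q ^ 2 * w - q * (q + 1) - 2 * (q ^ 2 * m - q * n)) / 3 + (q ^ 2 * m - q * n)] := by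
  have hK : (q ^ 2 - q) * (q - 1) ≠ 0 := by
    rw [show (q ^ 2 - q) * (q - 1) = q * (q - 1) ^ 2 by ring]
    exact mul_ne_zero h0 (pow_ne_zero _ h1)
  simp only [Fin.sum_univ_six, cons_val, mul_zero, zero_mul, add_zero] at *
  have t0 : t 0 = 1 := mul_left_cancel₀ (mul_ne_zero hK hq) (by linear_combination huniv)
  rw [t0] at h012 h01 h03 hzero hempty
  have t1 : t 1 = q * n - (q + 1) := mul_left_cancel₀ hK (by linear_combination h012)
  rw [t1] at h01 hzero hempty
  have t2 : t 2 = q ^ 2 * m - q * n := mul_left_cancel₀ hK (by linear_combination h01)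
  rw [t2] at h03 hzero hempty
  have t3 : t 3 = (q ^ 2 * w - q * (q + 1) - 2 * (q ^ 2 * m - q * n)) / 6 :=
    mul_left_cancel₀ (pow_ne_zero 2 h1) (by linear_combination h03 / 6)
  rw [t3] at hzero hempty
  have t4 : t 4 = q ^ 3 * l - q ^ 2 * m
      - (q ^ 2 * w - q * (q + 1) - 2 * (q ^ 2 * m - q * n)) / 2 - (q ^ 2 * m - q * n) :=
    mul_left_cancel₀ hK (by linear_combination hzero)
  rw [t4] at hempty
  have t5 : t 5 = q ^ 4 * z + q - q ^ 3 * l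
      + (q ^ 2 * w - q * (q + 1) - 2 * (q ^ 2 * m - q * n)) / 3 + (q ^ 2 * m - q * n) :=
    mul_left_cancel₀ (mul_ne_zero hK hq) (by linear_combination hempty)
  ext j
  fin_cases j
  exacts [t0, t1, t2, t3, t4, t5]

theorem natCast_card_sub_one : ((Fintype.card F - 1 : ℕ) : ℂ) = Fintype.card F - 1 := by
  rw [Nat.cast_sub Fintype.card_pos, Nat.cast_one]

theorem natCast_card_sq_sub_card :
    ((Fintype.card F ^ 2 - Fintype.card F : ℕ) : ℂ) = Fintype.card F ^ 2 - Fintype.card F := by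
  rw [Nat.cast_sub (Nat.le_self_pow two_ne_zero _), Nat.cast_pow]

/-- The Fourier transform, up to the factor `q⁴`, of the indicator function of the orbit of `r`. -/
def orbitSum (p : ℕ) [Fact p.Prime] [CharP F p] (r y : Fin 4 → F) : ℂ :=
  ∑ x, (if InOrbit r x then 1 else 0) * psiF p F (bformBC x y)

theorem orbitSum_orbitRep (p : ℕ) [Fact p.Prime] [CharP F p] (h3ne : (3 : F) ≠ 0)
    {a₂ b₂ a₃ b₃ c₃ : F}
    (h2 : Irreducible (Polynomial.X ^ 2 + Polynomial.C a₂ * Polynomial.X + Polynomial.C b₂ :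
      Polynomial F))
    (h3 : Irreducible (Polynomial.X ^ 3 + Polynomial.C a₃ * Polynomial.X ^ 2 +
      Polynomial.C b₃ * Polynomial.X + Polynomial.C c₃ : Polynomial F))
    {i : Fin 6} {y : Fin 4 → F} (hy : InOrbit (orbitRep a₂ b₂ a₃ b₃ c₃ i) y)
    {q n m w l z : ℂ} (hq : q = Fintype.card F)
    (hw : (vanishCount {1, 2} (orbitRep a₂ b₂ a₃ b₃ c₃ i) : ℂ) = (q - 1) ^ 2 * w)
    (hn : n = ![q + 1, 1, 2, 3, 1, 0] i) (hm : m = ![q + 1, 1, 1, 0, 0, 0] i)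
    (hl : l = ![q + 1, 1, 0, 0, 0, 0] i) (hz : z = ![1, 0, 0, 0, 0, 0] i) :
    (fun j => orbitSum p (orbitRep a₂ b₂ a₃ b₃ c₃ j) y)
      = ![1, q * n - (q + 1), q ^ 2 * m - q * n,
      (q ^ 2 * w - q * (q + 1) - 2 * (q ^ 2 * m - q * n)) / 6,
      q ^ 3 * l - q ^ 2 * m - (q ^ 2 * w - q * (q + 1) - 2 * (q ^ 2 * m - q * n)) / 2
        - (q ^ 2 * m - q * n),
      q ^ 4 * z + q - q ^ 3 * l
        + (q ^ 2 * w - q * (q + 1) - 2 * (q ^ 2 * m - q * n)) / 3 + (q ^ 2 * m - q * n)] := by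
  have hrel := fun S => sum_vanishCount_mul_orbitSum p h3ne (existsUnique_inOrbit h2 h3) S y
  simp only [← hq] at hrel
  have hcard1 := natCast_card_sub_one (F := F)
  have hcard2 := natCast_card_sq_sub_card (F := F)
  rw [← hq] at hcard1 hcard2
  have c0 : ∀ j, (vanishCount {0} (orbitRep a₂ b₂ a₃ b₃ c₃ j) : ℂ)
      = (q ^ 2 - q) * (q - 1) * ![q + 1, 1, 2, 3, 1, 0] j := by
    intro j
    rw [vanishCount_zero_orbitRep h2 h3, Nat.cast_mul, Nat.cast_mul, hcard1, hcard2]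
    fin_cases j <;> simp [hq]
  have c01 : ∀ j, (vanishCount {0, 1} (orbitRep a₂ b₂ a₃ b₃ c₃ j) : ℂ)
      = (q ^ 2 - q) * (q - 1) * ![q + 1, 1, 1, 0, 0, 0] j := by
    intro j
    rw [vanishCount_zero_one_orbitRep h2 h3, Nat.cast_mul, Nat.cast_mul, hcard1, hcard2]
    fin_cases j <;> simp [hq]
  have c012 : ∀ j, (vanishCount {0, 1, 2} (orbitRep a₂ b₂ a₃ b₃ c₃ j) : ℂ)
      = (q ^ 2 - q) * (q - 1) * ![q + 1, 1, 0, 0, 0, 0] j := by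
    intro j
    rw [vanishCount_zero_one_two_orbitRep h2 h3, Nat.cast_mul, Nat.cast_mul, hcard1, hcard2]
    fin_cases j <;> simp [hq]
  have c03 : ∀ j, (vanishCount {0, 3} (orbitRep a₂ b₂ a₃ b₃ c₃ j) : ℂ)
      = (q - 1) ^ 2 * ![q * (q + 1), 0, 2, 6, 0, 0] j := by
    intro j
    rw [vanishCount_zero_three_orbitRep h2 h3, Nat.cast_mul, Nat.cast_pow, hcard1]
    fin_cases j <;> simp [hq]
  have cuniv : ∀ j, (vanishCount Finset.univ (orbitRep a₂ b₂ a₃ b₃ c₃ j) : ℂ)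
      = (q ^ 2 - q) * (q - 1) * ![q + 1, 0, 0, 0, 0, 0] j := by
    intro j
    rw [vanishCount_univ_orbitRep, Nat.cast_mul, Nat.cast_mul, hcard1, hcard2]
    fin_cases j <;> simp [hq]
  have cempty : ∀ x : Fin 4 → F, (vanishCount ∅ x : ℂ) = (q ^ 2 - q) * (q - 1) * (q + 1) := by
    intro x
    rw [vanishCount_empty, card_sq_sub_one_mul, Nat.cast_mul, Nat.cast_mul, hcard1, hcard2]
    simp [hq]
  have hrev : ∀ S, vanishCount (S.image Fin.rev) y
      = vanishCount S (orbitRep a₂ b₂ a₃ b₃ c₃ i) :=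
    fun S => (vanishCount_rev S y).trans (vanishCount_eq_of_inOrbit S hy)
  have hcard : 1 < Fintype.card F := Fintype.one_lt_card
  apply orbitSum_eq_of_relations (q := q)
  · rw [hq]
    exact_mod_cast (by omega : Fintype.card F ≠ 0)
  · rw [← hcard1]
    exact_mod_cast (by omega : Fintype.card F - 1 ≠ 0)
  · have := hrel Finset.univ
    simp only [cuniv] at this
    refine this.trans ?_
    rw [show (Finset.univᶜ : Finset (Fin 4)) = ∅ from rfl, cempty]
    simp
  · have := hrel {0, 1, 2}
    simp only [c012] at this
    refine this.trans ?_
    rw [show ({0, 1, 2}ᶜ : Finset (Fin 4)) = Finset.image Fin.rev {0} by decide, hrev, c0, hn]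
    simp
  · have := hrel {0, 1}
    simp only [c01] at this
    refine this.trans ?_
    rw [show ({0, 1}ᶜ : Finset (Fin 4)) = Finset.image Fin.rev {0, 1} by decide, hrev, c01, hm]
    simp
  · have := hrel {0, 3}
    simp only [c03] at this
    refine this.trans ?_
    rw [show ({0, 3}ᶜ : Finset (Fin 4)) = {1, 2} by decide, vanishCount_eq_of_inOrbit _ hy, hw]
    simp
  · have := hrel {0}
    simp only [c0] at this
    refine this.trans ?_
    rw [show ({0}ᶜ : Finset (Fin 4)) = Finset.image Fin.rev {0, 1, 2} by decide, hrev, c012, hl]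
    simp
  · have := hrel ∅
    simp only [cempty] at this
    refine this.trans ?_
    rw [show (∅ᶜ : Finset (Fin 4)) = Finset.univ from rfl, vanishCount_eq_of_inOrbit _ hy, cuniv,
      hz]
    fin_cases i <;> simp
  · rw [hq]
    exact Nat.cast_add_one_ne_zero _

theorem card_mod_three_ne_zero (p : ℕ) [Fact p.Prime] [CharP F p] (h3 : (3 : F) ≠ 0) :
    Fintype.card F % 3 ≠ 0 := by
  intro h
  obtain ⟨n, hp, hn⟩ := FiniteField.card F p
  have h3p : 3 ∣ p := Nat.prime_three.dvd_of_dvd_pow (hn ▸ Nat.dvd_of_mod_eq_zero h)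
  obtain rfl := (Nat.prime_dvd_prime_iff_eq Nat.prime_three hp).1 h3p
  exact h3 (by exact_mod_cast CharP.cast_eq_zero F 3)

theorem vanishCount_one_two_relation (p : ℕ) [Fact p.Prime] [CharP F p] (h3ne : (3 : F) ≠ 0)
    {a₂ b₂ a₃ b₃ c₃ : F}
    (h2 : Irreducible (Polynomial.X ^ 2 + Polynomial.C a₂ * Polynomial.X + Polynomial.C b₂ :
      Polynomial F))
    (h3 : Irreducible (Polynomial.X ^ 3 + Polynomial.C a₃ * Polynomial.X ^ 2 +
      Polynomial.C b₃ * Polynomial.X + Polynomial.C c₃ : Polynomial F)) {q : ℂ}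
    (hq : q = Fintype.card F) :
    (vanishCount {1, 2} ![0, 1, -1, (0 : F)] : ℂ) + 3 * vanishCount {1, 2} ![0, 1, a₂, b₂]
      + 2 * vanishCount {1, 2} ![1, a₃, b₃, c₃] = 6 * (q - 1) ^ 2 := by
  have hcard : 1 < Fintype.card F := Fintype.one_lt_card
  have hcard1 := natCast_card_sub_one (F := F)
  have hcard2 := natCast_card_sq_sub_card (F := F)
  rw [← hq] at hcard1 hcard2
  have v0 : ∀ S, (vanishCount S ![0, 0, 0, (0 : F)] : ℂ) = (q - 1) ^ 2 * (q * (q + 1)) := by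
    intro S
    rw [vanishCount_zero_form, card_sq_sub_one_mul, Nat.cast_mul, Nat.cast_mul, hcard1, hcard2,
      Nat.cast_add, ← hq]
    ring
  have v1 : (vanishCount {1, 2} ![0, 0, 0, (1 : F)] : ℂ) = (q - 1) ^ 2 * (2 * q) := by
    rw [vanishCount_one_two_cube h3ne, Nat.cast_mul, Nat.cast_mul, hcard1, hcard2]
    ring
  have hself : InOrbit (orbitRep a₂ b₂ a₃ b₃ c₃ 0) ![0, 0, 0, 0] :=
    inOrbit_iff.2 ⟨1, coeffAct_one _⟩
  have ht := fun j => congrFun (orbitSum_orbitRep p h3ne h2 h3 hself hq (v0 {1, 2}) rfl rfl rfl rfl) j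
  have hrel := sum_vanishCount_mul_orbitSum p h3ne (existsUnique_inOrbit h2 h3) {1, 2}
    ![0, 0, 0, 0]
  simp only [← orbitSum.eq_1, ht] at hrel
  rw [v0, ← hq] at hrel
  simp only [orbitRep, Fin.sum_univ_six, cons_val, v0, v1, vanishCount_one_two_double h3ne] at hrel
  rw [show ({1, 2}ᶜ : Finset (Fin 4)).card = 2 from rfl] at hrel
  have hne : (q - 1) ^ 2 * (q * (q + 1)) ≠ 0 := by
    refine mul_ne_zero (pow_ne_zero _ ?_) (mul_ne_zero ?_ ?_)
    · rw [← hcard1]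
      exact_mod_cast (by omega : Fintype.card F - 1 ≠ 0)
    · rw [hq]
      exact_mod_cast (by omega : Fintype.card F ≠ 0)
    · rw [hq]
      exact Nat.cast_add_one_ne_zero _
  refine mul_left_cancel₀ hne ?_
  linear_combination 6 * hrel

theorem vanishCount_one_two_orbitRep (p : ℕ) [Fact p.Prime] [CharP F p] (h3ne : (3 : F) ≠ 0)
    {a₂ b₂ a₃ b₃ c₃ : F}
    (h2 : Irreducible (Polynomial.X ^ 2 + Polynomial.C a₂ * Polynomial.X + Polynomial.C b₂ :
      Polynomial F))
    (h3 : Irreducible (Polynomial.X ^ 3 + Polynomial.C a₃ * Polynomial.X ^ 2 +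
      Polynomial.C b₃ * Polynomial.X + Polynomial.C c₃ : Polynomial F)) {q ε : ℂ}
    (hq : q = Fintype.card F) (hε : ε = if Fintype.card F % 3 = 1 then 1 else -1) (i : Fin 6) :
    (vanishCount {1, 2} (orbitRep a₂ b₂ a₃ b₃ c₃ i) : ℂ)
      = (q - 1) ^ 2 * ![q * (q + 1), 2 * q, 0, 1 + ε, 1 - ε, 1 + ε] i := by
  have hcard : 1 < Fintype.card F := Fintype.one_lt_card
  have hcard1 := natCast_card_sub_one (F := F)
  have hcard2 := natCast_card_sq_sub_card (F := F)
  rw [← hq] at hcard1 hcard2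
  have hrel := vanishCount_one_two_relation p h3ne h2 h3 hq
  have hmod := card_mod_three_ne_zero p h3ne
  have h03 : (vanishCount {0, 3} ![0, 0, 1, (0 : F)] : ℂ) = (q - 1) ^ 2 * 2 := by
    rw [← hcard1]
    exact_mod_cast vanishCount_zero_three_orbitRep h2 h3 2
  have h345 : (vanishCount {1, 2} ![0, 1, -1, (0 : F)] : ℂ) = (q - 1) ^ 2 * (1 + ε) ∧
      (vanishCount {1, 2} ![0, 1, a₂, b₂] : ℂ) = (q - 1) ^ 2 * (1 - ε) ∧
      (vanishCount {1, 2} ![1, a₃, b₃, c₃] : ℂ) = (q - 1) ^ 2 * (1 + ε) := by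
    by_cases hmod1 : Fintype.card F % 3 = 1
    · obtain ⟨ω, hω⟩ := exists_cube_root_of_one hmod1
      have v3 := vanishCount_one_two_split_of_cube_root hω h3ne
      have v4 : vanishCount {1, 2} ![0, 1, a₂, b₂] = 0 := by
        refine vanishCount_one_two_eq_zero_of_cube_root hω h3ne ?_
          (vanishCount_zero_one_irreducible_quadratic h2) (vanishCount_zero_three_orbitRep h2 h3 4)
        exact vanishCount_ne_zero_of_inOrbit
          (inOrbit_iff.2 ⟨1, coeffAct_one _⟩) (by simp)
      rw [if_pos hmod1] at hε
      rw [v3, v4, h03] at hrel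
      rw [v3, v4, h03]
      refine ⟨by rw [hε]; ring, by rw [hε]; simp, ?_⟩
      rw [hε]
      push_cast at hrel
      linear_combination hrel / 2
    · have hbij := bijective_cube (F := F) (by omega)
      have v3 : vanishCount {1, 2} ![0, 1, -1, (0 : F)] = 0 := by
        refine vanishCount_one_two_eq_zero_of_injective hbij.1 vanishCount_zero_one_split ?_
        exact vanishCount_ne_zero_of_inOrbit
          (inOrbit_iff.2 ⟨1, coeffAct_one _⟩) (by simp)
      have v5 : vanishCount {1, 2} ![1, a₃, b₃, c₃] = 0 :=
        vanishCount_one_two_eq_zero_of_surjective hbij.2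
          (vanishCount_irreducible_cubic h3 (by simp))
      rw [if_neg hmod1] at hε
      rw [v3, v5] at hrel ⊢
      refine ⟨by rw [hε]; simp, ?_, by rw [hε]; simp⟩
      rw [hε]
      push_cast at hrel
      linear_combination hrel / 3
  fin_cases i
  · refine (congrArg _ (vanishCount_zero_form _)).trans ?_
    rw [card_sq_sub_one_mul, Nat.cast_mul, Nat.cast_mul, hcard1, hcard2, Nat.cast_add, ← hq]
    simp
    ring
  · refine (congrArg _ (vanishCount_one_two_cube h3ne)).trans ?_
    rw [Nat.cast_mul, Nat.cast_mul, hcard1, hcard2]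
    simp
    ring
  · refine (congrArg _ (vanishCount_one_two_double h3ne)).trans ?_
    simp
  · exact h345.1
  · exact h345.2.1
  · exact h345.2.2

/-- the Fourier transform matrix for binary cubic forms (Mori's theorem). -/
theorem stmt7 (p : ℕ) [Fact p.Prime] [CharP F p] (hp : p ≠ 3)
    (a₂ b₂ a₃ b₃ c₃ : F)
    (h2 : Irreducible (Polynomial.X ^ 2 + Polynomial.C a₂ * Polynomial.X + Polynomial.C b₂ :
      Polynomial F))
    (h3 : Irreducible (Polynomial.X ^ 3 + Polynomial.C a₃ * Polynomial.X ^ 2 +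
      Polynomial.C b₃ * Polynomial.X + Polynomial.C c₃ : Polynomial F)) :
    let r : Fin 6 → Fin 4 → F :=
      ![![0,0,0,0], ![0,0,0,1], ![0,0,1,0], ![0,1,-1,0], ![0,1,a₂,b₂], ![1,a₃,b₃,c₃]]
    let q : ℚ := (Fintype.card F : ℚ)
    let ε : ℚ := if Fintype.card F % 3 = 1 then 1 else -1
    let M : Matrix (Fin 6) (Fin 6) ℚ :=
      !![1, q^2-1, q^3-q, (q^2-1)*(q^2-q)/6, (q^2-1)*(q^2-q)/2, (q^2-1)*(q^2-q)/3;
         1, -1, q^2-q, q*(q-1)*(2*q-1)/6, -(q*(q-1)/2), -(q*(q^2-1)/3);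
         1, q-1, q^2-2*q, -(3*q*(q-1)/6), -(q*(q-1)/2), 0;
         1, 2*q-1, -(3*q), q*(5+ε*q)/6, -(q*(-1+ε*q)/2), q*(-1+ε*q)/3;
         1, -1, -q, -(q*(-1+ε*q)/6), q*(1+ε*q)/2, -(q*(-1+ε*q)/3);
         1, -q-1, 0, q*(-1+ε*q)/6, -(q*(-1+ε*q)/2), q*(2+ε*q)/3]
    ∀ (i j : Fin 6) (y : Fin 4 → F), InOrbit (r i) y →
      (Fintype.card F : ℂ) ^ 4 * FTBC p (fun x => if InOrbit (r j) x then 1 else 0) y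
        = (M i j : ℂ) := by
  intro r q ε M i j y hy
  have h3ne : (3 : F) ≠ 0 := by
    intro h
    have hdvd := (CharP.cast_eq_zero_iff F p 3).1 (by exact_mod_cast h)
    exact hp ((Nat.prime_dvd_prime_iff_eq Fact.out Nat.prime_three).1 hdvd)
  have hcard : (Fintype.card F : ℂ) ≠ 0 := by
    exact_mod_cast Fintype.card_ne_zero
  have hε : ((ε : ℚ) : ℂ) = if Fintype.card F % 3 = 1 then 1 else -1 := by
    simp only [ε]
    split_ifs <;> simp
  have hqc : ((q : ℚ) : ℂ) = Fintype.card F := by simp [q]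
  have ht := congrFun (orbitSum_orbitRep p h3ne h2 h3 hy hqc
    (vanishCount_one_two_orbitRep p h3ne h2 h3 hqc hε i) rfl rfl rfl rfl) j
  rw [FTBC, mul_inv_cancel_left₀ (pow_ne_zero 4 hcard)]
  refine Eq.trans ht ?_
  clear_value ε
  fin_cases i <;> fin_cases j <;>
  · simp only [M, of_apply, cons_val', cons_val, Fin.zero_eta, Fin.mk_one, Fin.reduceFinMk]
    push_cast
    ring

end
end

section
/- Assume p ∉ {2, 3}, and let ψ : F_q^× → {±1} be the quadratic character, extended by ψ(0) = 0. Then for every binary cubic form y over F_q: q^{-4} Σ_{x∈V} ψ(Disc(x)) · exp(2π√(-1) · Tr_{F_q/F_p}([x,y])/p) = q^{-2} · ψ(−Disc(y)/27). -/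
open scoped Classical
open MvPolynomial Matrix

noncomputable section

variable {F : Type*} [Field F] [Fintype F]

/-- The discriminant of the binary cubic form `(a,b,c,d)`. -/
def DiscBC (x : Fin 4 → F) : F :=
  (x 1)^2 * (x 2)^2 + 18 * (x 0) * (x 1) * (x 2) * (x 3) - 4 * (x 0) * (x 2)^3
    - 4 * (x 1)^3 * (x 3) - 27 * (x 0)^2 * (x 3)^2

/-- The quadratic character of `F`, extended by `0 ↦ 0`, with values in `ℂ`. -/
def qchar (a : F) : ℂ := if a = 0 then 0 else if IsSquare a then 1 else -1

lemma sum_affine {R : Type*} [AddCommMonoid R] (f : F → R) {k : F} (hk : k ≠ 0) (m : F) :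
    ∑ c, f (k * c + m) = ∑ c, f c :=
  Fintype.sum_equiv ((Equiv.mulLeft₀ k hk).trans (Equiv.addRight m)) _ _ fun _ => rfl

lemma quadraticChar_sq_eq_ite (b : F) : quadraticChar F (b ^ 2) = if b = 0 then 0 else 1 := by
  split_ifs with h
  · simp [h]
  · exact quadraticChar_sq_one' h

lemma sum_ite_ne_zero : ∑ b : F, (if b = 0 then 0 else 1 : ℤ) = Fintype.card F - 1 := by
  have h : ∀ b : F, (if b = 0 then 0 else 1 : ℤ) = 1 - if b = 0 then 1 else 0 := by
    intro b; split_ifs <;> simp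
  simp [h, Finset.sum_sub_distrib]

lemma sum_quadraticChar_disc (h2 : (2 : F) ≠ 0) :
    ∑ A : F, ∑ B : F, ∑ C : F, quadraticChar F (B ^ 2 - 4 * A * C) =
      Fintype.card F * (Fintype.card F - 1) := by
  have h4 : (4 : F) ≠ 0 := by
    rw [show (4 : F) = 2 * 2 by norm_num]; exact mul_ne_zero h2 h2
  have hchar : ringChar F ≠ 2 := fun h => h2 (by
    have := ringChar.Nat.cast_ringChar (R := F)
    rw [h] at this; exact_mod_cast this)
  rw [Finset.sum_eq_single_of_mem (0 : F) (Finset.mem_univ _)]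
  · simp only [mul_zero, zero_mul, sub_zero, quadraticChar_sq_eq_ite, Finset.sum_const,
      Finset.card_univ, nsmul_eq_mul, ← Finset.mul_sum, sum_ite_ne_zero]
  · intro A _ hA
    refine Finset.sum_eq_zero fun B _ => ?_
    have hk : -(4 * A) ≠ 0 := neg_ne_zero.2 (mul_ne_zero h4 hA)
    refine Eq.trans ?_ ((sum_affine (quadraticChar F) hk (B ^ 2)).trans
      (quadraticChar_sum_zero hchar))
    exact Finset.sum_congr rfl fun C _ => by ring_nf

/-- Weighted count of the quadratic forms `(A, B, C)` apolar to the cubic form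
with binomial coordinates `(a, b, c, d)`. -/
lemma sum_apolar (h2 : (2 : F) ≠ 0) (a b c d : F) :
    ∑ A : F, ∑ B : F, ∑ C : F,
      (if A * a + B * b + C * c = 0 ∧ A * b + B * c + C * d = 0 then
        quadraticChar F (B ^ 2 - 4 * A * C) else 0) =
      (Fintype.card F - 1) *
        quadraticChar F ((a * d - b * c) ^ 2 - 4 * (a * c - b ^ 2) * (b * d - c ^ 2)) +
      Fintype.card F * (Fintype.card F - 1) *
        (if a * c = b ^ 2 ∧ a * d = b * c ∧ b * d = c ^ 2 then 1 else 0) := by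
  by_cases h : a * c = b ^ 2 ∧ a * d = b * c ∧ b * d = c ^ 2
  · rw [if_pos h]
    obtain ⟨h1, h3, h5⟩ := h
    rw [show (a * d - b * c) ^ 2 - 4 * (a * c - b ^ 2) * (b * d - c ^ 2) = 0 by
      rw [h1, h3]; ring, MulChar.map_zero]
    have key : ∀ k : F, ∑ B : F, ∑ C : F, quadraticChar F ((B + k * C) ^ 2) =
        (Fintype.card F : ℤ) * (Fintype.card F - 1) := by
      intro k
      rw [Finset.sum_comm]
      have : ∀ C : F, ∑ B : F, quadraticChar F ((B + k * C) ^ 2) =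
          (Fintype.card F : ℤ) - 1 := by
        intro C
        have := sum_affine (fun B : F => quadraticChar F (B ^ 2)) one_ne_zero (k * C)
        simp only [one_mul] at this
        rw [this]
        simp only [quadraticChar_sq_eq_ite, sum_ite_ne_zero]
      simp only [this, Finset.sum_const, Finset.card_univ, nsmul_eq_mul]
    by_cases ha : a = 0
    · subst ha
      have hb : b = 0 := by simpa using h1.symm
      subst hb
      have hc : c = 0 := by simpa using h5.symm
      subst hc
      by_cases hd : d = 0
      · subst hd
        simp [-quadraticChar_apply, sum_quadraticChar_disc h2]
      · have : ∀ A B C : F, (if A * 0 + B * 0 + C * 0 = 0 ∧ A * 0 + B * 0 + C * d = 0 then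
            quadraticChar F (B ^ 2 - 4 * A * C) else 0) =
            if C = 0 then quadraticChar F (B ^ 2) else 0 := by
          intro A B C
          by_cases hC : C = 0 <;> simp [-quadraticChar_apply, hC, hd]
        simp only [this]
        simp [-quadraticChar_apply, quadraticChar_sq_eq_ite, sum_ite_ne_zero, mul_sub]
    · obtain ⟨r, rfl⟩ : ∃ r, b = r * a := ⟨b / a, by field_simp⟩
      have hc : c = r ^ 2 * a := mul_left_cancel₀ ha (by rw [h1]; ring)
      subst hc
      have hd : d = r ^ 3 * a := mul_left_cancel₀ ha (by rw [h3]; ring)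
      subst hd
      have : ∀ A B C : F, (if A * a + B * (r * a) + C * (r ^ 2 * a) = 0 ∧
            A * (r * a) + B * (r ^ 2 * a) + C * (r ^ 3 * a) = 0 then
            quadraticChar F (B ^ 2 - 4 * A * C) else 0) =
            if A = -(B * r + C * r ^ 2) then quadraticChar F ((B + 2 * r * C) ^ 2) else 0 := by
        intro A B C
        have e : (A * a + B * (r * a) + C * (r ^ 2 * a) = 0 ∧
            A * (r * a) + B * (r ^ 2 * a) + C * (r ^ 3 * a) = 0) ↔
            A = -(B * r + C * r ^ 2) := by
          constructor
          · rintro ⟨h, -⟩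
            have : a * (A + (B * r + C * r ^ 2)) = 0 := by linear_combination h
            exact eq_neg_of_add_eq_zero_left ((mul_eq_zero.1 this).resolve_left ha)
          · rintro rfl
            constructor <;> ring
        by_cases hA : A = -(B * r + C * r ^ 2)
        · rw [if_pos (e.2 hA), if_pos hA, hA]
          ring_nf
        · rw [if_neg (mt e.1 hA), if_neg hA]
      simp only [this]
      rw [mul_zero, zero_add, mul_one, ← key (2 * r), Finset.sum_comm]
      refine Finset.sum_congr rfl fun B _ => Finset.sum_comm.trans ?_
      simp only [Finset.sum_ite_eq', Finset.mem_univ, if_true]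
  · rw [if_neg h, mul_zero, add_zero]
    set P := b * d - c ^ 2 with hP
    set Q := b * c - a * d with hQ
    set R := a * c - b ^ 2 with hR
    have hne : P ≠ 0 ∨ Q ≠ 0 ∨ R ≠ 0 := by
      by_contra! hh
      exact h ⟨sub_eq_zero.1 hh.2.2, (sub_eq_zero.1 hh.2.1).symm, sub_eq_zero.1 hh.1⟩
    have expand : ∀ A B C : F,
        (if A * a + B * b + C * c = 0 ∧ A * b + B * c + C * d = 0 then
          quadraticChar F (B ^ 2 - 4 * A * C) else 0) =
        ∑ k : F, if (A = k * P ∧ B = k * Q ∧ C = k * R) then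
          quadraticChar F (B ^ 2 - 4 * A * C) else 0 := by
      intro A B C
      split_ifs with hr
      · obtain ⟨r1, r2⟩ := hr
        have e1 : A * Q = B * P := by rw [hP, hQ]; linear_combination -d * r1 + c * r2
        have e2 : B * R = C * Q := by rw [hR, hQ]; linear_combination a * r2 - b * r1
        have e3 : A * R = C * P := by rw [hR, hP]; linear_combination c * r1 - b * r2
        obtain ⟨k, hk⟩ : ∃ k, A = k * P ∧ B = k * Q ∧ C = k * R := by
          rcases hne with h0 | h0 | h0
          · refine ⟨A / P, ?_, ?_, ?_⟩ <;> field_simp <;> simp [e1, e3]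
          · refine ⟨B / Q, ?_, ?_, ?_⟩ <;> field_simp <;> simp [e1, e2]
          · refine ⟨C / R, ?_, ?_, ?_⟩ <;> field_simp <;> simp [e2, e3]
        rw [Finset.sum_eq_single_of_mem k (Finset.mem_univ _), if_pos hk]
        intro j _ hj
        refine if_neg fun hj' => hj ?_
        rcases hne with h0 | h0 | h0
        · exact mul_right_cancel₀ h0 (hj'.1.symm.trans hk.1)
        · exact mul_right_cancel₀ h0 (hj'.2.1.symm.trans hk.2.1)
        · exact mul_right_cancel₀ h0 (hj'.2.2.symm.trans hk.2.2)
      · refine (Finset.sum_eq_zero fun k _ => if_neg ?_).symm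
        rintro ⟨rfl, rfl, rfl⟩
        exact hr ⟨by rw [hP, hQ, hR]; ring, by rw [hP, hQ, hR]; ring⟩
    simp only [expand]
    have swap : ∀ f : F → F → F → F → ℤ, ∑ A, ∑ B, ∑ C, ∑ k, f A B C k =
        ∑ k, ∑ A, ∑ B, ∑ C, f A B C k := by
      intro f
      simp only [← Fintype.sum_prod_type']
      exact Fintype.sum_equiv ⟨fun x => (x.2.2.2, x.1, x.2.1, x.2.2.1),
        fun x => (x.2.1, x.2.2.1, x.2.2.2, x.1), fun _ => rfl, fun _ => rfl⟩ _ _ fun _ => rfl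
    rw [swap]
    simp only [ite_and, Finset.sum_ite_eq', Finset.sum_ite_irrel, Finset.sum_const_zero,
      Finset.mem_univ, if_true]
    have : ∀ k : F, quadraticChar F ((k * Q) ^ 2 - 4 * (k * P) * (k * R)) =
        (if k = 0 then 0 else 1) *
          quadraticChar F ((a * d - b * c) ^ 2 - 4 * R * P) := by
      intro k
      rw [← quadraticChar_sq_eq_ite, ← map_mul]
      congr 1
      rw [hQ]; ring
    simp only [this]
    rw [← Finset.sum_mul, sum_ite_ne_zero]

/-- The sum of `χ(disc Q)` over all factorizations of the cubic form `(a, b, c, d)` as a quadratic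
form `Q` times a linear form. -/
def factorSum (a b c d : F) : ℤ :=
  ∑ Q : F × F × F, ∑ M : F × F,
    if M.1 * Q.1 = a ∧ M.1 * Q.2.1 + M.2 * Q.1 = b ∧ M.1 * Q.2.2 + M.2 * Q.2.1 = c ∧
      M.2 * Q.2.2 = d then quadraticChar F (Q.2.1 ^ 2 - 4 * Q.1 * Q.2.2) else 0

/-- The number of zeros in the affine plane of the cubic form `(a, b, c, d)`. -/
def zeroCount (a b c d : F) : ℤ :=
  ∑ z : F × F, if a * z.1 ^ 3 + b * z.1 ^ 2 * z.2 + c * z.1 * z.2 ^ 2 + d * z.2 ^ 3 = 0 then 1 else 0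

lemma discBC_cons {K : Type*} [Field K] (a b c d : K) : DiscBC ![a, b, c, d] =
    b ^ 2 * c ^ 2 + 18 * a * b * c * d - 4 * a * c ^ 3 - 4 * b ^ 3 * d - 27 * a ^ 2 * d ^ 2 := by
  simp [DiscBC]

lemma factorSum_reverse (a b c d : F) : factorSum d c b a = factorSum a b c d := by
  refine Fintype.sum_equiv ⟨fun Q => (Q.2.2, Q.2.1, Q.1), fun Q => (Q.2.2, Q.2.1, Q.1),
    fun _ => rfl, fun _ => rfl⟩ _ _ fun Q => Fintype.sum_equiv (Equiv.prodComm F F) _ _ fun M => ?_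
  have e : (M.1 * Q.1 = d ∧ M.1 * Q.2.1 + M.2 * Q.1 = c ∧ M.1 * Q.2.2 + M.2 * Q.2.1 = b ∧
      M.2 * Q.2.2 = a) ↔ (M.2 * Q.2.2 = a ∧ M.2 * Q.2.1 + M.1 * Q.2.2 = b ∧
      M.2 * Q.1 + M.1 * Q.2.1 = c ∧ M.1 * Q.1 = d) := by
    rw [add_comm (M.2 * Q.2.1), add_comm (M.2 * Q.1)]; tauto
  simp only [Equiv.coe_fn_mk, Equiv.prodComm_apply, Prod.fst_swap, Prod.snd_swap]
  simp only [e, mul_right_comm]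

lemma zeroCount_reverse (a b c d : F) : zeroCount d c b a = zeroCount a b c d := by
  refine Fintype.sum_equiv (Equiv.prodComm F F) _ _ fun z => ?_
  simp only [Equiv.prodComm_apply, Prod.fst_swap, Prod.snd_swap]
  congr 2
  ring

lemma factorSum_shift (a b c d k : F) :
    factorSum a (b + 3 * a * k) (c + 2 * b * k + 3 * a * k ^ 2)
      (d + c * k + b * k ^ 2 + a * k ^ 3) = factorSum a b c d := by
  symm
  refine Fintype.sum_equiv ⟨fun Q => (Q.1, Q.2.1 + 2 * k * Q.1, Q.2.2 + k * Q.2.1 + k ^ 2 * Q.1),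
    fun Q => (Q.1, Q.2.1 - 2 * k * Q.1, Q.2.2 - k * Q.2.1 + k ^ 2 * Q.1),
    fun Q => ?_, fun Q => ?_⟩ _ _ fun Q => Fintype.sum_equiv
      ⟨fun M => (M.1, M.2 + k * M.1), fun M => (M.1, M.2 - k * M.1), fun M => ?_, fun M => ?_⟩
      _ _ fun M => ?_
  · ext <;> simp; ring
  · ext <;> simp; ring
  · ext <;> simp
  · ext <;> simp
  · simp only [Equiv.coe_fn_mk]
    refine if_congr ⟨?_, ?_⟩ (congrArg _ (by ring)) rfl
    · rintro ⟨h1, h2, h3, h4⟩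
      refine ⟨h1, ?_, ?_, ?_⟩
      · linear_combination h2 + 3 * k * h1
      · linear_combination h3 + 2 * k * h2 + 3 * k ^ 2 * h1
      · linear_combination h4 + k * h3 + k ^ 2 * h2 + k ^ 3 * h1
    · rintro ⟨h1, h2, h3, h4⟩
      refine ⟨h1, ?_, ?_, ?_⟩
      · linear_combination h2 - 3 * k * h1
      · linear_combination h3 - 2 * k * h2 + 3 * k ^ 2 * h1
      · linear_combination h4 - k * h3 + k ^ 2 * h2 - k ^ 3 * h1

lemma zeroCount_shift (a b c d k : F) :
    zeroCount a (b + 3 * a * k) (c + 2 * b * k + 3 * a * k ^ 2)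
      (d + c * k + b * k ^ 2 + a * k ^ 3) = zeroCount a b c d := by
  refine Fintype.sum_equiv ⟨fun z => (z.1 + k * z.2, z.2), fun z => (z.1 - k * z.2, z.2),
    fun z => ?_, fun z => ?_⟩ _ _ fun z => ?_
  · ext <;> simp
  · ext <;> simp
  · simp only [Equiv.coe_fn_mk]
    congr 2
    ring

lemma factorSum_eq_add_count (h2 : (2 : F) ≠ 0) (a b c : F) :
    factorSum a b c 0 = (if a = 0 ∧ b = 0 ∧ c = 0 then
        (Fintype.card F : ℤ) * (Fintype.card F - 1) else 0) +
      (Fintype.card F - 1) * quadraticChar F (b ^ 2 - 4 * a * c) +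
      (if c = 0 then 0 else 1) * ∑ s : F, ∑ t : F,
        (if t = 0 then 0 else if a * t ^ 2 - b * s * t + c * s ^ 2 = 0 then 1 else 0) := by
  unfold factorSum
  rw [Finset.sum_comm, Fintype.sum_prod_type]
  have split : ∀ f : F → F → ℤ, ∑ s, ∑ t, f s t =
      f 0 0 + ∑ s, (if s = 0 then 0 else f s 0) + ∑ s, ∑ t, (if t = 0 then 0 else f s t) := by
    intro f
    have h : ∀ s t, f s t = (if t = 0 then (if s = 0 then f 0 0 else 0) +
        (if s = 0 then 0 else f s 0) else 0) + (if t = 0 then 0 else f s t) := by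
      intro s t
      by_cases ht : t = 0 <;> by_cases hs : s = 0 <;> simp [hs, ht]
    conv_lhs => enter [2, s, 2, t]; rw [h s t]
    simp [Finset.sum_add_distrib]
  rw [split]
  congr 1
  · congr 1
    · simp only [zero_mul, add_zero, eq_comm (a := (0 : F)), and_true, Finset.sum_ite_irrel,
        Finset.sum_const_zero, Fintype.sum_prod_type, sum_quadraticChar_disc h2]
    · have h : ∀ s : F, s ≠ 0 → ∑ Q : F × F × F,
          (if s * Q.1 = a ∧ s * Q.2.1 + 0 * Q.1 = b ∧ s * Q.2.2 + 0 * Q.2.1 = c ∧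
            0 * Q.2.2 = 0 then quadraticChar F (Q.2.1 ^ 2 - 4 * Q.1 * Q.2.2) else 0) =
          quadraticChar F (b ^ 2 - 4 * a * c) := by
        intro s hs
        rw [Finset.sum_eq_single_of_mem (s⁻¹ * a, s⁻¹ * b, s⁻¹ * c) (Finset.mem_univ _)]
        · rw [if_pos (by simp [hs])]
          rw [show (s⁻¹ * b) ^ 2 - 4 * (s⁻¹ * a) * (s⁻¹ * c) =
            s⁻¹ ^ 2 * (b ^ 2 - 4 * a * c) by ring, map_mul,
            quadraticChar_sq_one' (inv_ne_zero hs), one_mul]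
        · rintro ⟨A, B, C⟩ _ hQ
          refine if_neg ?_
          rintro ⟨rfl, rfl, rfl, -⟩
          simp [hs] at hQ
      have h' : ∀ s : F, (if s = 0 then 0 else ∑ Q : F × F × F,
          (if s * Q.1 = a ∧ s * Q.2.1 + 0 * Q.1 = b ∧ s * Q.2.2 + 0 * Q.2.1 = c ∧
            0 * Q.2.2 = 0 then quadraticChar F (Q.2.1 ^ 2 - 4 * Q.1 * Q.2.2) else 0)) =
          (if s = 0 then 0 else 1) * quadraticChar F (b ^ 2 - 4 * a * c) := by
        intro s
        by_cases hs : s = 0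
        · simp [hs]
        · rw [if_neg hs, if_neg hs, h s hs, one_mul]
      simp only [h']
      rw [← Finset.sum_mul, sum_ite_ne_zero]
  · rw [Finset.mul_sum]
    refine Finset.sum_congr rfl fun s _ => ?_
    rw [Finset.mul_sum]
    refine Finset.sum_congr rfl fun t _ => ?_
    by_cases ht : t = 0
    · simp [ht]
    rw [if_neg ht, if_neg ht, Finset.sum_eq_single_of_mem
      ((b - s * (t⁻¹ * c)) * t⁻¹, t⁻¹ * c, 0) (Finset.mem_univ _)]
    · simp only [mul_zero, sub_zero, zero_add, mul_inv_cancel_left₀ ht, and_true,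
        quadraticChar_sq_eq_ite, mul_eq_zero, inv_eq_zero, ht, false_or]
      have e : (s * ((b - s * (t⁻¹ * c)) * t⁻¹) = a ∧
          s * (t⁻¹ * c) + t * ((b - s * (t⁻¹ * c)) * t⁻¹) = b) ↔
          a * t ^ 2 - b * s * t + c * s ^ 2 = 0 := by
        constructor
        · rintro ⟨h, -⟩
          rw [← h]; field_simp; ring
        · intro h
          constructor
          · field_simp; linear_combination -h
          · field_simp; ring
      simp only [e]
      split_ifs <;> simp
    · rintro ⟨A, B, C⟩ _ hQ
      refine if_neg ?_
      rintro ⟨-, h2, h3, h4⟩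
      have hC : C = 0 := (mul_eq_zero.1 h4).resolve_left ht
      subst hC
      apply hQ
      simp only [mul_zero, zero_add] at h2 h3
      subst h3 h2
      ext <;> simp [ht]
      field_simp

lemma factorSum_of_unit_root (h2 : (2 : F) ≠ 0) (a b c : F) :
    factorSum a b c 0 = (Fintype.card F - 1) * quadraticChar F (DiscBC ![a, b, c, 0]) +
      zeroCount a b c 0 - Fintype.card F := by
  set K : ℤ := ∑ s : F, ∑ t : F,
    (if t = 0 then 0 else if a * t ^ 2 - b * s * t + c * s ^ 2 = 0 then 1 else 0) with hK
  have hN : zeroCount a b c 0 = Fintype.card F + K := by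
    unfold zeroCount
    have h : ∀ z : F × F, (if a * z.1 ^ 3 + b * z.1 ^ 2 * z.2 + c * z.1 * z.2 ^ 2 + 0 * z.2 ^ 3 = 0
        then 1 else 0 : ℤ) = (if z.1 = 0 then 1 else 0) + (if z.1 = 0 then 0 else
          if a * z.1 ^ 2 - b * (-1 * z.2 + 0) * z.1 + c * (-1 * z.2 + 0) ^ 2 = 0 then 1 else 0) := by
      rintro ⟨u, v⟩
      by_cases hu : u = 0
      · simp [hu]
      · have : a * u ^ 3 + b * u ^ 2 * v + c * u * v ^ 2 + 0 * v ^ 3 =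
          u * (a * u ^ 2 - b * (-1 * v + 0) * u + c * (-1 * v + 0) ^ 2) := by ring
        simp only [this, mul_eq_zero, hu, false_or, if_false, zero_add]
    simp only [h, Finset.sum_add_distrib]
    congr 1
    · rw [Fintype.sum_prod_type, Finset.sum_comm]
      simp
    · rw [Fintype.sum_prod_type, Finset.sum_comm, hK, sum_affine (fun s => ∑ t : F,
        if t = 0 then 0 else if a * t ^ 2 - b * s * t + c * s ^ 2 = 0 then (1 : ℤ) else 0)
        (neg_ne_zero.2 one_ne_zero) 0]
  have hD : quadraticChar F (DiscBC ![a, b, c, 0]) =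
      (if c = 0 then 0 else 1) * quadraticChar F (b ^ 2 - 4 * a * c) := by
    rw [← quadraticChar_sq_eq_ite, ← map_mul, discBC_cons]
    congr 1
    ring
  rw [hN, hD, factorSum_eq_add_count h2, ← hK]
  by_cases hc : c = 0
  · subst hc
    have hK' : K = (if a = 0 ∧ b = 0 then (Fintype.card F : ℤ) * (Fintype.card F - 1) else 0) +
        (Fintype.card F - 1) * (if b = 0 then 0 else 1) := by
      by_cases hb : b = 0
      · subst hb
        rw [hK]
        by_cases ha : a = 0
        · simp [ha, sum_ite_ne_zero, mul_sub]
        · have : ∀ t : F, (if t = 0 then 0 else if a * t ^ 2 = 0 then 1 else 0 : ℤ) = 0 := by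
            intro t
            by_cases ht : t = 0 <;> simp [ht, ha]
          simp only [zero_mul, sub_zero, add_zero, this]
          simp [ha]
      · rw [hK, Finset.sum_comm]
        have : ∀ t : F, ∑ s : F,
            (if t = 0 then 0 else if a * t ^ 2 - b * s * t + 0 * s ^ 2 = 0 then 1 else 0 : ℤ) =
            if t = 0 then 0 else 1 := by
          intro t
          by_cases ht : t = 0
          · simp [ht]
          · have e : ∀ s : F, a * t ^ 2 - b * s * t + 0 * s ^ 2 = 0 ↔ s = a * t / b := by
              intro s
              rw [eq_div_iff hb]
              constructor
              · intro h
                exact mul_right_cancel₀ ht (by linear_combination -h)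
              · intro h
                linear_combination -t * h
            simp only [ht, e, if_false, Finset.sum_ite_eq', Finset.mem_univ, if_true]
        simp only [this, sum_ite_ne_zero]
        simp [hb]
    rw [hK', mul_zero, sub_zero, quadraticChar_sq_eq_ite]
    simp
  · simp only [hc, and_false, if_false]
    ring

lemma factorSum_of_root (h2 : (2 : F) ≠ 0) (a b c d : F) {z : F × F} (hz : z ≠ 0)
    (h : a * z.1 ^ 3 + b * z.1 ^ 2 * z.2 + c * z.1 * z.2 ^ 2 + d * z.2 ^ 3 = 0) :
    factorSum a b c d = (Fintype.card F - 1) * quadraticChar F (DiscBC ![a, b, c, d]) +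
      zeroCount a b c d - Fintype.card F := by
  obtain ⟨u, v⟩ := z
  simp only at h
  by_cases hv : v = 0
  · subst hv
    have hu : u ≠ 0 := by rintro rfl; exact hz rfl
    have ha : a = 0 := by simpa [hu] using h
    subst ha
    rw [← factorSum_reverse, ← zeroCount_reverse, factorSum_of_unit_root h2, discBC_cons,
      discBC_cons]
    ring_nf
  · set k := u / v with hk
    have hd : d + c * k + b * k ^ 2 + a * k ^ 3 = 0 := by
      rw [hk]; field_simp; linear_combination h
    rw [← factorSum_shift a b c d k, ← zeroCount_shift a b c d k, hd, factorSum_of_unit_root h2]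
    congr 4
    rw [← hd, discBC_cons, discBC_cons]
    ring

lemma factorSum_of_forall_ne_zero (a b c d : F) (h : ∀ z : F × F, z ≠ 0 →
      a * z.1 ^ 3 + b * z.1 ^ 2 * z.2 + c * z.1 * z.2 ^ 2 + d * z.2 ^ 3 ≠ 0) :
    factorSum a b c d = 0 ∧ zeroCount a b c d = 1 := by
  constructor
  · refine Finset.sum_eq_zero fun Q _ => Finset.sum_eq_zero fun M _ => if_neg ?_
    rintro ⟨rfl, rfl, rfl, rfl⟩
    by_cases hM : M = 0
    · refine h (1, 0) (by simp) ?_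
      simp [hM]
    · refine h (M.2, -M.1) (fun h' => hM ?_) (by ring)
      simp only [Prod.mk_eq_zero, neg_eq_zero] at h'
      exact Prod.ext h'.2 h'.1
  · unfold zeroCount
    rw [Finset.sum_eq_single_of_mem (0 : F × F) (Finset.mem_univ _) fun z _ hz => if_neg (h z hz)]
    simp

/-- The discriminant of the Hessian of the cubic form with binomial coordinates `(a, b, c, d)`. -/
def hessianDisc {K : Type*} [Field K] (x : K × K × K × K) : K :=
  (x.1 * x.2.2.2 - x.2.1 * x.2.2.1) ^ 2 -
    4 * (x.1 * x.2.2.1 - x.2.1 ^ 2) * (x.2.1 * x.2.2.2 - x.2.2.1 ^ 2)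

/-- The standard bilinear pairing on `F ^ 4`. -/
def pairing (x y : F × F × F × F) : F :=
  x.1 * y.1 + x.2.1 * y.2.1 + x.2.2.1 * y.2.2.1 + x.2.2.2 * y.2.2.2

lemma sum_addChar_pairing {e : AddChar F ℂ}
    (he : ∀ c, ∑ t, e (t * c) = if c = 0 then (Fintype.card F : ℂ) else 0) (y : F × F × F × F) :
    ∑ x, e (pairing x y) = if y = 0 then (Fintype.card F : ℂ) ^ 4 else 0 := by
  obtain ⟨a, b, c, d⟩ := y
  simp only [pairing, AddChar.map_add_eq_mul, Fintype.sum_prod_type, ← Finset.mul_sum,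
    ← Finset.sum_mul, he, Prod.mk_eq_zero]
  split_ifs <;> simp_all
  ring

lemma sum_addChar_neg {e : AddChar F ℂ}
    (he : ∀ c, ∑ t, e (t * c) = if c = 0 then (Fintype.card F : ℂ) else 0) (u v : F) :
    ∑ M : F × F, e (-(M.1 * u + M.2 * v)) =
      if u = 0 ∧ v = 0 then (Fintype.card F : ℂ) ^ 2 else 0 := by
  simp only [neg_add, ← mul_neg, AddChar.map_add_eq_mul, Fintype.sum_prod_type, ← Finset.mul_sum,
    ← Finset.sum_mul, he, neg_eq_zero]
  split_ifs <;> simp_all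
  ring

lemma card_ne_zero_complex : (Fintype.card F : ℂ) ≠ 0 :=
  Nat.cast_ne_zero.2 Fintype.card_ne_zero

/-- The Fourier transform of the weighted count of apolar quadratic forms. -/
lemma sum_apolar_mul_addChar {e : AddChar F ℂ}
    (he : ∀ c, ∑ t, e (t * c) = if c = 0 then (Fintype.card F : ℂ) else 0) (y : F × F × F × F) :
    ∑ x : F × F × F × F, ((∑ A : F, ∑ B : F, ∑ C : F,
      (if A * x.1 + B * x.2.1 + C * x.2.2.1 = 0 ∧ A * x.2.1 + B * x.2.2.1 + C * x.2.2.2 = 0 then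
        quadraticChar F (B ^ 2 - 4 * A * C) else 0) : ℤ) : ℂ) * e (pairing x y) =
      (Fintype.card F : ℂ) ^ 2 * factorSum y.1 y.2.1 y.2.2.1 y.2.2.2 := by
  have hq := pow_ne_zero 2 (card_ne_zero_complex (F := F))
  apply mul_left_cancel₀ hq
  have h : ∀ x : F × F × F × F, (Fintype.card F : ℂ) ^ 2 * (((∑ A : F, ∑ B : F, ∑ C : F,
      (if A * x.1 + B * x.2.1 + C * x.2.2.1 = 0 ∧ A * x.2.1 + B * x.2.2.1 + C * x.2.2.2 = 0 then
        quadraticChar F (B ^ 2 - 4 * A * C) else 0) : ℤ) : ℂ) * e (pairing x y)) =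
      ∑ Q : F × F × F, ∑ M : F × F, (quadraticChar F (Q.2.1 ^ 2 - 4 * Q.1 * Q.2.2) : ℂ) *
        e (pairing x (y - (M.1 * Q.1, M.1 * Q.2.1 + M.2 * Q.1, M.1 * Q.2.2 + M.2 * Q.2.1,
          M.2 * Q.2.2))) := by
    intro x
    have h' : ∀ (Q : F × F × F) (M : F × F), e (pairing x (y - (M.1 * Q.1,
        M.1 * Q.2.1 + M.2 * Q.1, M.1 * Q.2.2 + M.2 * Q.2.1, M.2 * Q.2.2))) =
        e (-(M.1 * (Q.1 * x.1 + Q.2.1 * x.2.1 + Q.2.2 * x.2.2.1) +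
          M.2 * (Q.1 * x.2.1 + Q.2.1 * x.2.2.1 + Q.2.2 * x.2.2.2))) * e (pairing x y) := by
      intro Q M
      rw [← AddChar.map_add_eq_mul]
      congr 1
      simp only [pairing, Prod.fst_sub, Prod.snd_sub]
      ring
    simp only [h', ← Finset.mul_sum, ← Finset.sum_mul, sum_addChar_neg he, ← mul_assoc]
    congr 1
    push_cast
    simp only [Fintype.sum_prod_type, Finset.mul_sum]
    refine Finset.sum_congr rfl fun A _ => Finset.sum_congr rfl fun B _ =>
      Finset.sum_congr rfl fun C _ => ?_
    split_ifs <;> ring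
  rw [Finset.mul_sum, Finset.sum_congr rfl fun x _ => h x, Finset.sum_comm]
  unfold factorSum
  push_cast
  rw [Finset.mul_sum, Finset.mul_sum]
  refine Finset.sum_congr rfl fun Q _ => ?_
  rw [Finset.sum_comm, Finset.mul_sum, Finset.mul_sum]
  refine Finset.sum_congr rfl fun M _ => ?_
  rw [← Finset.mul_sum, sum_addChar_pairing he]
  obtain ⟨y0, y1, y2, y3⟩ := y
  have e : ((y0, y1, y2, y3) - (M.1 * Q.1, M.1 * Q.2.1 + M.2 * Q.1, M.1 * Q.2.2 + M.2 * Q.2.1,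
      M.2 * Q.2.2) = 0) ↔ (M.1 * Q.1 = y0 ∧ M.1 * Q.2.1 + M.2 * Q.1 = y1 ∧
      M.1 * Q.2.2 + M.2 * Q.2.1 = y2 ∧ M.2 * Q.2.2 = y3) := by
    rw [sub_eq_zero, eq_comm]; simp only [Prod.mk.injEq]
  simp only [e]
  split_ifs <;> ring

lemma zeroCount_eq (a b c d : F) :
    zeroCount a b c d = 1 + ((Fintype.card F : ℤ) - 1) * (if d = 0 then 1 else 0) +
      ((Fintype.card F : ℤ) - 1) * ∑ r : F, if a + b * r + c * r ^ 2 + d * r ^ 3 = 0 then 1 else 0 := by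
  unfold zeroCount
  rw [Fintype.sum_prod_type]
  have h : ∀ s : F, ∑ t : F,
      (if a * s ^ 3 + b * s ^ 2 * t + c * s * t ^ 2 + d * t ^ 3 = 0 then 1 else 0 : ℤ) =
      (if s = 0 then (1 : ℤ) + ((Fintype.card F : ℤ) - 1) * (if d = 0 then 1 else 0) else 0) +
      (if s = 0 then 0 else 1) *
        ∑ r : F, if a + b * r + c * r ^ 2 + d * r ^ 3 = 0 then 1 else 0 := by
    intro s
    by_cases hs : s = 0
    · subst hs
      by_cases hd : d = 0 <;> simp [hd]
    · rw [if_neg hs, if_neg hs, zero_add, one_mul,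
        ← sum_affine (fun t => if a * s ^ 3 + b * s ^ 2 * t + c * s * t ^ 2 + d * t ^ 3 = 0
          then (1 : ℤ) else 0) hs 0]
      refine Finset.sum_congr rfl fun r _ => ?_
      have : a * s ^ 3 + b * s ^ 2 * (s * r + 0) + c * s * (s * r + 0) ^ 2 +
          d * (s * r + 0) ^ 3 = s ^ 3 * (a + b * r + c * r ^ 2 + d * r ^ 3) := by ring
      simp only [this, mul_eq_zero, pow_eq_zero_iff three_ne_zero, hs, false_or]
  simp only [h, Finset.sum_add_distrib, ← Finset.sum_mul, sum_ite_ne_zero]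
  simp

/-- The Fourier transform of the indicator function of the cone over the twisted cubic. -/
lemma sum_twisted_cubic {e : AddChar F ℂ}
    (he : ∀ c, ∑ t, e (t * c) = if c = 0 then (Fintype.card F : ℂ) else 0) (y : F × F × F × F) :
    ((Fintype.card F : ℂ) - 1) * ∑ x : F × F × F × F,
      (if x.1 * x.2.2.1 = x.2.1 ^ 2 ∧ x.1 * x.2.2.2 = x.2.1 * x.2.2.1 ∧
        x.2.1 * x.2.2.2 = x.2.2.1 ^ 2 then 1 else 0) * e (pairing x y) =
      Fintype.card F * zeroCount y.1 y.2.1 y.2.2.1 y.2.2.2 - (Fintype.card F : ℂ) ^ 2 := by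
  obtain ⟨y0, y1, y2, y3⟩ := y
  have key : ∑ x : F × F × F × F,
      (if x.1 * x.2.2.1 = x.2.1 ^ 2 ∧ x.1 * x.2.2.2 = x.2.1 * x.2.2.1 ∧
        x.2.1 * x.2.2.2 = x.2.2.1 ^ 2 then 1 else 0) * e (pairing x (y0, y1, y2, y3)) =
      (if y3 = 0 then (Fintype.card F : ℂ) else 0) +
      ∑ r : F, ((if y0 + y1 * r + y2 * r ^ 2 + y3 * r ^ 3 = 0 then (Fintype.card F : ℂ) else 0)
        - 1) := by
    have hr : ∀ r : F, (if y0 + y1 * r + y2 * r ^ 2 + y3 * r ^ 3 = 0 then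
        (Fintype.card F : ℂ) else 0) - 1 =
        ∑ a : F, if a = 0 then 0 else e (a * (y0 + y1 * r + y2 * r ^ 2 + y3 * r ^ 3)) := by
      intro r
      rw [← he]
      have : ∀ a : F, (if a = 0 then 0 else e (a * (y0 + y1 * r + y2 * r ^ 2 + y3 * r ^ 3))) =
          e (a * (y0 + y1 * r + y2 * r ^ 2 + y3 * r ^ 3)) - if a = 0 then 1 else 0 := by
        intro a
        by_cases ha : a = 0 <;> simp [ha]
      simp [this, Finset.sum_sub_distrib]
    simp only [hr]
    rw [Finset.sum_comm, ← he y3, Fintype.sum_prod_type]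
    have ha : ∀ a : F, ∑ x : F × F × F, (if a * x.2.1 = x.1 ^ 2 ∧ a * x.2.2 = x.1 * x.2.1 ∧
        x.1 * x.2.2 = x.2.1 ^ 2 then 1 else 0) * e (pairing (a, x) (y0, y1, y2, y3)) =
        (if a = 0 then ∑ t : F, e (t * y3) else 0) + ∑ r : F, if a = 0 then 0 else
          e (a * (y0 + y1 * r + y2 * r ^ 2 + y3 * r ^ 3)) := by
      intro a
      by_cases ha : a = 0
      · subst ha
        simp only [if_true, Finset.sum_const_zero, add_zero]
        have e0 : ∀ b c d : F, (0 * c = b ^ 2 ∧ 0 * d = b * c ∧ b * d = c ^ 2) ↔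
            b = 0 ∧ c = 0 := by
          intro b c d
          constructor
          · rintro ⟨h1, -, h3⟩
            have hb : b = 0 := by simpa using h1.symm
            subst hb
            exact ⟨rfl, by simpa using h3.symm⟩
          · rintro ⟨rfl, rfl⟩
            simp
        simp only [e0]
        simp only [Fintype.sum_prod_type, ite_and, ite_mul, zero_mul, one_mul,
          Finset.sum_ite_irrel, Finset.sum_const_zero, Finset.sum_ite_eq', Finset.mem_univ,
          if_true, pairing, zero_add]
      · simp only [ha, if_false, zero_add]
        have e1 : ∀ b c d : F, (a * c = b ^ 2 ∧ a * d = b * c ∧ b * d = c ^ 2) ↔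
            c = b ^ 2 / a ∧ d = b ^ 3 / a ^ 2 := by
          intro b c d
          constructor
          · rintro ⟨h1, h3, -⟩
            constructor
            · field_simp; linear_combination h1
            · field_simp; linear_combination a * h3 + b * h1
          · rintro ⟨rfl, rfl⟩
            refine ⟨?_, ?_, ?_⟩ <;> field_simp
        simp only [Fintype.sum_prod_type, e1, ite_and, ite_mul, zero_mul, one_mul,
          Finset.sum_ite_irrel, Finset.sum_const_zero, Finset.sum_ite_eq', Finset.mem_univ,
          if_true]
        rw [← sum_affine _ ha 0]
        refine Finset.sum_congr rfl fun r _ => ?_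
        congr 1
        simp only [pairing]
        field_simp
        ring
    rw [Finset.sum_congr rfl fun a _ => ha a, Finset.sum_add_distrib]
    simp
  rw [key, zeroCount_eq]
  push_cast
  have h : ∑ r : F, (if y0 + y1 * r + y2 * r ^ 2 + y3 * r ^ 3 = 0 then
      (Fintype.card F : ℂ) else 0) = Fintype.card F *
      ∑ r : F, if y0 + y1 * r + y2 * r ^ 2 + y3 * r ^ 3 = 0 then (1 : ℂ) else 0 := by
    rw [Finset.mul_sum]
    exact Finset.sum_congr rfl fun r _ => by rw [mul_ite, mul_one, mul_zero]
  rw [Finset.sum_sub_distrib, h, Finset.sum_const, Finset.card_univ, nsmul_eq_mul]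
  by_cases hy : y3 = 0
  · simp only [hy, if_true]; ring
  · simp only [hy, if_false]; ring

lemma sum_hessianDisc_mul_addChar (h2 : (2 : F) ≠ 0) {e : AddChar F ℂ}
    (he : ∀ c, ∑ t, e (t * c) = if c = 0 then (Fintype.card F : ℂ) else 0) (y : F × F × F × F) :
    ((Fintype.card F : ℂ) - 1) * ∑ x, (quadraticChar F (hessianDisc x) : ℂ) * e (pairing x y) =
      (Fintype.card F : ℂ) ^ 2 * ((factorSum y.1 y.2.1 y.2.2.1 y.2.2.2 -
        zeroCount y.1 y.2.1 y.2.2.1 y.2.2.2 + Fintype.card F : ℤ) : ℂ) := by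
  have h := sum_apolar_mul_addChar he y
  simp only [sum_apolar h2] at h
  push_cast at h
  simp only [add_mul, Finset.sum_add_distrib, mul_assoc, ← Finset.mul_sum] at h
  have h' := sum_twisted_cubic he y
  push_cast
  simp only [hessianDisc]
  simp only [mul_assoc] at h' ⊢
  linear_combination h - (Fintype.card F : ℂ) * h'

lemma discBC_three_mul {K : Type*} [Field K] (x : K × K × K × K) :
    DiscBC ![x.1, 3 * x.2.1, 3 * x.2.2.1, x.2.2.2] = -27 * hessianDisc x := by
  rw [discBC_cons, hessianDisc]
  ring

/-- The equivalence sending the coefficients of a cubic form to its binomial coordinates. -/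
def binomialCoords (h3 : (3 : F) ≠ 0) : F × F × F × F ≃ (Fin 4 → F) where
  toFun x := ![x.1, 3 * x.2.1, 3 * x.2.2.1, x.2.2.2]
  invFun x := (x 0, x 1 / 3, x 2 / 3, x 3)
  left_inv x := by ext <;> simp [h3]
  right_inv x := by
    ext i
    fin_cases i <;> simp <;> field_simp

lemma sum_quadraticChar_discBC (h3 : (3 : F) ≠ 0) (f : (Fin 4 → F) → ℂ) :
    ∑ x, (quadraticChar F (DiscBC x) : ℂ) * f x = quadraticChar F (-27 : F) *
      ∑ x : F × F × F × F, (quadraticChar F (hessianDisc x) : ℂ) * f (binomialCoords h3 x) := by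
  rw [← Equiv.sum_comp (binomialCoords h3), Finset.mul_sum]
  refine Finset.sum_congr rfl fun x _ => ?_
  rw [show binomialCoords h3 x = ![x.1, 3 * x.2.1, 3 * x.2.2.1, x.2.2.2] from rfl,
    discBC_three_mul, map_mul, Int.cast_mul, mul_assoc]

lemma factorSum_eq (h2 : (2 : F) ≠ 0) (h3 : (3 : F) ≠ 0) {e : AddChar F ℂ}
    (he : ∀ c, ∑ t, e (t * c) = if c = 0 then (Fintype.card F : ℂ) else 0) (y : F × F × F × F) :
    factorSum y.1 y.2.1 y.2.2.1 y.2.2.2 - zeroCount y.1 y.2.1 y.2.2.1 y.2.2.2 + Fintype.card F =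
      (Fintype.card F - 1) * quadraticChar F (DiscBC ![y.1, y.2.1, y.2.2.1, y.2.2.2]) := by
  set G : F × F × F × F → ℤ := fun y =>
    factorSum y.1 y.2.1 y.2.2.1 y.2.2.2 - zeroCount y.1 y.2.1 y.2.2.1 y.2.2.2 + Fintype.card F
    with hG
  have hq : (1 : ℤ) < Fintype.card F := by exact_mod_cast Fintype.one_lt_card
  have hqC : (Fintype.card F : ℂ) ≠ 0 := card_ne_zero_complex
  have hqC1 : (Fintype.card F : ℂ) - 1 ≠ 0 := by
    rw [sub_ne_zero]; exact_mod_cast hq.ne'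
  have hle : ∀ y ∈ Finset.univ, 0 ≤ G y - (Fintype.card F - 1) *
      quadraticChar F (DiscBC ![y.1, y.2.1, y.2.2.1, y.2.2.2]) := by
    rintro ⟨a, b, c, d⟩ -
    simp only [hG]
    by_cases hz : ∃ z : F × F, z ≠ 0 ∧
        a * z.1 ^ 3 + b * z.1 ^ 2 * z.2 + c * z.1 * z.2 ^ 2 + d * z.2 ^ 3 = 0
    · obtain ⟨z, hz0, hz⟩ := hz
      rw [factorSum_of_root h2 a b c d hz0 hz]
      linarith
    · push Not at hz
      obtain ⟨h, h'⟩ := factorSum_of_forall_ne_zero a b c d hz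
      rw [h, h']
      have : quadraticChar F (DiscBC ![a, b, c, d]) ≤ 1 := by
        by_cases h0 : DiscBC ![a, b, c, d] = 0
        · rw [h0, MulChar.map_zero]; norm_num
        · rcases quadraticChar_dichotomy h0 with h | h <;> rw [h]; norm_num
      nlinarith
  have hsumG : ∑ y, G y = 0 := by
    have h : (Fintype.card F : ℂ) ^ 2 * ((∑ y, G y : ℤ) : ℂ) = 0 := by
      push_cast
      rw [Finset.mul_sum, ← Finset.sum_congr rfl fun y _ => sum_hessianDisc_mul_addChar h2 he y,
        ← Finset.mul_sum, Finset.sum_comm]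
      have h' : ∀ x : F × F × F × F, ∑ y, (quadraticChar F (hessianDisc x) : ℂ) *
          e (pairing x y) = 0 := by
        intro x
        have hc : ∀ y, pairing x y = pairing y x := fun y => by simp only [pairing]; ring
        simp only [← Finset.mul_sum, hc, sum_addChar_pairing he]
        by_cases hx : x = 0
        · subst hx; simp [hessianDisc]
        · simp [hx]
      simp [-quadraticChar_apply, h']
    exact_mod_cast (mul_eq_zero.1 h).resolve_left (pow_ne_zero 2 hqC)
  have hsumD : ∑ y : F × F × F × F,
      quadraticChar F (DiscBC ![y.1, y.2.1, y.2.2.1, y.2.2.2]) = 0 := by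
    have h0 := sum_hessianDisc_mul_addChar h2 he (0 : F × F × F × F)
    have hroot := factorSum_of_root h2 (0 : F) 0 0 0 (z := (1, 0)) (by simp) (by simp)
    simp only [Prod.fst_zero, Prod.snd_zero, hroot] at h0
    rw [discBC_cons] at h0
    have hp : ∀ x : F × F × F × F, pairing x 0 = 0 := fun x => by simp [pairing]
    simp only [hp, AddChar.map_zero_eq_one, mul_one] at h0
    have h1 : ∑ x : F × F × F × F, (quadraticChar F (hessianDisc x) : ℂ) = 0 := by
      refine (mul_eq_zero.1 (h0.trans ?_)).resolve_left hqC1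
      simp
    have h2' := sum_quadraticChar_discBC h3 (fun _ => (1 : ℂ))
    simp only [mul_one, h1, mul_zero] at h2'
    have h4 : ∑ y : F × F × F × F,
        quadraticChar F (DiscBC ![y.1, y.2.1, y.2.2.1, y.2.2.2]) =
        ∑ x : Fin 4 → F, quadraticChar F (DiscBC x) :=
      Fintype.sum_equiv ⟨fun y => ![y.1, y.2.1, y.2.2.1, y.2.2.2],
        fun x => (x 0, x 1, x 2, x 3), fun _ => rfl,
        fun x => by ext i; fin_cases i <;> rfl⟩ _ _ fun _ => rfl
    rw [h4]
    exact_mod_cast h2'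
  have hsum : ∑ y, (G y - (Fintype.card F - 1) *
      quadraticChar F (DiscBC ![y.1, y.2.1, y.2.2.1, y.2.2.2])) = 0 := by
    rw [Finset.sum_sub_distrib, hsumG, ← Finset.mul_sum, hsumD]
    simp
  exact sub_eq_zero.1 ((Finset.sum_eq_zero_iff_of_nonneg hle).1 hsum y (Finset.mem_univ _))

lemma sum_discBC_mul_addChar (h2 : (2 : F) ≠ 0) (h3 : (3 : F) ≠ 0) {e : AddChar F ℂ}
    (he : ∀ c, ∑ t, e (t * c) = if c = 0 then (Fintype.card F : ℂ) else 0) (y : Fin 4 → F) :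
    ∑ x, (quadraticChar F (DiscBC x) : ℂ) * e (bformBC x y) =
      (Fintype.card F : ℂ) ^ 2 * quadraticChar F (-(DiscBC y) / 27) := by
  have hqC1 : (Fintype.card F : ℂ) - 1 ≠ 0 := by
    rw [sub_ne_zero]; exact_mod_cast (Fintype.one_lt_card (α := F)).ne'
  have h27 : (27 : F) ≠ 0 := by
    rw [show (27 : F) = 3 ^ 3 by norm_num]; exact pow_ne_zero 3 h3
  rw [sum_quadraticChar_discBC h3 (fun x => e (bformBC x y))]
  have hb : ∀ x, bformBC (binomialCoords h3 x) y = pairing x (y 0, y 1, y 2, y 3) := by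
    intro x
    simp only [bformBC, binomialCoords, pairing, Equiv.coe_fn_mk]
    simp
    field_simp
  have h := sum_hessianDisc_mul_addChar h2 he (y 0, y 1, y 2, y 3)
  rw [factorSum_eq h2 h3 he (y 0, y 1, y 2, y 3)] at h
  have hy : ![y 0, y 1, y 2, y 3] = y := by ext i; fin_cases i <;> rfl
  simp only [hy] at h
  have hD : -(DiscBC y) / 27 = (-27) * DiscBC y * (27⁻¹) ^ 2 := by field_simp
  rw [hD, map_mul, map_mul, quadraticChar_sq_one' (inv_ne_zero h27), mul_one]
  simp only [hb]
  apply mul_left_cancel₀ hqC1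
  push_cast at h ⊢
  linear_combination (quadraticChar F (-27 : F) : ℂ) * h

lemma qchar_eq (a : F) : qchar a = (quadraticChar F a : ℂ) := by
  simp only [qchar, quadraticChar_apply, quadraticCharFun]
  split_ifs <;> simp

lemma exists_addChar_psiF (p : ℕ) [Fact p.Prime] [CharP F p] : ∃ e : AddChar F ℂ,
    (∀ t, psiF p F t = e t) ∧
      ∀ c, ∑ t, e (t * c) = if c = 0 then (Fintype.card F : ℂ) else 0 := by
  let _ : Algebra (ZMod p) F := ZMod.algebra F p
  have : Module.Finite (ZMod p) F := Module.Finite.of_finite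
  set e : AddChar F ℂ :=
    (ZMod.stdAddChar (N := p)).compAddMonoidHom (Algebra.trace (ZMod p) F).toAddMonoidHom with he
  have hpsi : ∀ t, psiF p F t = e t := by
    intro t
    simp only [psiF, he, AddChar.compAddMonoidHom_apply, LinearMap.toAddMonoidHom_coe]
    conv_rhs => rw [← ZMod.natCast_zmod_val (Algebra.trace (ZMod p) F t)]
    have := ZMod.stdAddChar_coe (N := p) ((Algebra.trace (ZMod p) F t).val : ℤ)
    push_cast at this
    rw [this]
  refine ⟨e, hpsi, fun c => ?_⟩
  have hne : e ≠ 1 := by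
    intro h1
    obtain ⟨t, ht⟩ := Algebra.trace_surjective (ZMod p) F 1
    have h := DFunLike.congr_fun h1 t
    simp only [he, AddChar.compAddMonoidHom_apply, LinearMap.toAddMonoidHom_coe, ht,
      AddChar.one_apply] at h
    rw [← AddChar.map_zero_eq_one (ZMod.stdAddChar (N := p))] at h
    exact one_ne_zero (ZMod.injective_stdAddChar h)
  have hprim : e.IsPrimitive := AddChar.IsPrimitive.of_ne_one hne
  have := AddChar.sum_mulShift c hprim
  simpa using this

/-- Fourier transform of the quadratic character of the discriminant of
binary cubic forms. -/
theorem stmt9 (p : ℕ) [Fact p.Prime] [CharP F p] (hp2 : p ≠ 2) (hp3 : p ≠ 3)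
    (y : Fin 4 → F) :
    ((Fintype.card F : ℂ) ^ 4)⁻¹ *
        ∑ x : Fin 4 → F, qchar (DiscBC x) * psiF p F (bformBC x y)
      = ((Fintype.card F : ℂ) ^ 2)⁻¹ * qchar (-(DiscBC y) / 27) := by
  have hp : p.Prime := Fact.out
  have h2 : (2 : F) ≠ 0 := by
    intro h
    have := (CharP.cast_eq_zero_iff F p 2).1 (by exact_mod_cast h)
    exact hp2 ((Nat.prime_dvd_prime_iff_eq hp Nat.prime_two).1 this)
  have h3 : (3 : F) ≠ 0 := by
    intro h
    have := (CharP.cast_eq_zero_iff F p 3).1 (by exact_mod_cast h)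
    exact hp3 ((Nat.prime_dvd_prime_iff_eq hp Nat.prime_three).1 this)
  obtain ⟨e, hpsi, he⟩ := exists_addChar_psiF (F := F) p
  have hq := card_ne_zero_complex (F := F)
  simp only [qchar_eq, hpsi]
  rw [sum_discBC_mul_addChar h2 h3 he]
  field_simp

end
end

section
/- Assume p ≠ 2 and let l ∈ F_q^× be a non-square. The action of G = GL_1(F_q) × GL_2(F_q) on the space V of binary quadratic forms has exactly four orbits, with representatives 0, v^2, uv, and u^2 − l v^2; the rank (as a symmetric 2×2 matrix) of any element of these orbits is respectively 0, 1, 2, 2, and the orbit sizes are respectively 1, q^2 − 1, q(q^2 − 1)/2, and q(q − 1)^2/2. -/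
open scoped Classical
open MvPolynomial Matrix

noncomputable section

variable {F : Type*} [Field F] [Fintype F]

/-- The binary quadratic form `a u² + b uv + c v²` attached to `(a,b,c)`. -/
def toPolyBQ (x : Fin 3 → F) : MvPolynomial (Fin 2) F :=
  C (x 0) * X 0 ^ 2 + C (x 1) * X 0 * X 1 + C (x 2) * X 1 ^ 2

/-- `x` lies in the `GL₁(F) × GL₂(F)`-orbit of `r` (binary quadratic forms),
for the action `(g₁,g₂)·x(u,v) = g₁·x((u,v)g₂)`. -/
def InOrbitBQ (r x : Fin 3 → F) : Prop :=
  ∃ (t : Fˣ) (g : Matrix.GeneralLinearGroup (Fin 2) F),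
    C (t : F) * subst2 (g : Matrix (Fin 2) (Fin 2) F) (toPolyBQ r) = toPolyBQ x

/-- The symmetric 2×2 matrix attached to the binary quadratic form `(a,b,c)`. -/
def gram2 (x : Fin 3 → F) : Matrix (Fin 2) (Fin 2) F := !![x 0, x 1 / 2; x 1 / 2, x 2]

/-- The discriminant `b² - 4ac` of the binary quadratic form `(a,b,c)`. -/
def discBQ (x : Fin 3 → F) : F := x 1 ^ 2 - 4 * x 0 * x 2

lemma toPolyBQ_injective : Function.Injective (toPolyBQ (F := F)) := by
  intro x y h
  have h0 := congrArg (eval ![1, 0]) h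
  have h2 := congrArg (eval ![0, 1]) h
  have h1 := congrArg (eval ![1, 1]) h
  simp [toPolyBQ] at h0 h1 h2
  rw [h0, h2] at h1
  funext i
  fin_cases i
  · exact h0
  · simpa using h1
  · exact h2

lemma smul_subst2_toPolyBQ (t : F) (g : Matrix (Fin 2) (Fin 2) F) (r : Fin 3 → F) :
    C t * subst2 g (toPolyBQ r) = toPolyBQ
      ![t * (r 0 * g 0 0 ^ 2 + r 1 * g 0 0 * g 0 1 + r 2 * g 0 1 ^ 2),
        t * (2 * r 0 * g 0 0 * g 1 0 + r 1 * (g 0 0 * g 1 1 + g 1 0 * g 0 1)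
          + 2 * r 2 * g 0 1 * g 1 1),
        t * (r 0 * g 1 0 ^ 2 + r 1 * g 1 0 * g 1 1 + r 2 * g 1 1 ^ 2)] := by
  have h2 : (C (2 : F) : MvPolynomial (Fin 2) F) = 2 := map_ofNat C 2
  simp only [subst2, toPolyBQ, Fin.sum_univ_two, map_add, map_mul, map_pow, aeval_X,
    algHom_C, algebraMap_eq, Matrix.cons_val_zero, Matrix.cons_val_one, Matrix.cons_val, h2]
  ring

lemma inOrbitBQ_iff (r x : Fin 3 → F) :
    InOrbitBQ r x ↔ ∃ t a b c d : F, t ≠ 0 ∧ a * d - b * c ≠ 0 ∧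
      x 0 = t * (r 0 * a ^ 2 + r 1 * a * b + r 2 * b ^ 2) ∧
      x 1 = t * (2 * r 0 * a * c + r 1 * (a * d + c * b) + 2 * r 2 * b * d) ∧
      x 2 = t * (r 0 * c ^ 2 + r 1 * c * d + r 2 * d ^ 2) := by
  constructor
  · rintro ⟨t, g, h⟩
    rw [smul_subst2_toPolyBQ] at h
    obtain rfl := toPolyBQ_injective h
    refine ⟨t, g 0 0, g 0 1, g 1 0, g 1 1, t.ne_zero, ?_, rfl, rfl, rfl⟩
    rw [← Matrix.det_fin_two]
    exact (Matrix.isUnits_det_units g).ne_zero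
  · rintro ⟨t, a, b, c, d, ht, hdet, h0, h1, h2⟩
    refine ⟨Units.mk0 t ht, Matrix.GeneralLinearGroup.mkOfDetNeZero !![a, b; c, d]
      (by rwa [Matrix.det_fin_two_of]), ?_⟩
    rw [smul_subst2_toPolyBQ]
    congr 1
    funext i
    fin_cases i
    · exact h0.symm
    · exact h1.symm
    · exact h2.symm

lemma inOrbitBQ_zero_iff (x : Fin 3 → F) : InOrbitBQ ![0, 0, 0] x ↔ x = 0 := by
  rw [inOrbitBQ_iff]
  constructor
  · rintro ⟨t, a, b, c, d, -, -, h0, h1, h2⟩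
    funext i
    fin_cases i
    · simpa using h0
    · simpa using h1
    · simpa using h2
  · rintro rfl
    exact ⟨1, 1, 0, 0, 1, by simp⟩

lemma inOrbitBQ_sq_iff (h2 : (2 : F) ≠ 0) (x : Fin 3 → F) :
    InOrbitBQ ![0, 0, 1] x ↔ x ≠ 0 ∧ discBQ x = 0 := by
  rw [inOrbitBQ_iff, discBQ]
  constructor
  · rintro ⟨t, a, b, c, d, ht, hdet, h0, h1, h2⟩
    simp at h0 h1 h2
    refine ⟨?_, by rw [h0, h1, h2]; ring⟩
    rintro rfl
    have hb : b = 0 := by simpa [ht] using h0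
    have hd : d = 0 := by simpa [ht] using h2
    simp [hb, hd] at hdet
  · rintro ⟨hx, hD⟩
    by_cases h0 : x 0 = 0
    · have h1 : x 1 = 0 := by simpa [h0] using hD
      refine ⟨x 2, 1, 0, 0, 1, ?_, by simp, by simp [h0], by simp [h1], by simp⟩
      intro h2
      apply hx
      funext i
      fin_cases i
      · exact h0
      · exact h1
      · exact h2
    · refine ⟨x 0, 0, 1, 1, x 1 / (2 * x 0), h0, by simp, by simp, ?_, ?_⟩
      · simp
        field_simp
      · simp
        field_simp
        linear_combination -hD

lemma inOrbitBQ_split_iff (h2 : (2 : F) ≠ 0) (x : Fin 3 → F) :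
    InOrbitBQ ![0, 1, 0] x ↔ discBQ x ≠ 0 ∧ IsSquare (discBQ x) := by
  rw [inOrbitBQ_iff, discBQ]
  constructor
  · rintro ⟨t, a, b, c, d, ht, hdet, h0, h1, h2⟩
    simp at h0 h1 h2
    have h : x 1 ^ 2 - 4 * x 0 * x 2 = (t * (a * d - b * c)) * (t * (a * d - b * c)) := by
      rw [h0, h1, h2]; ring
    rw [h]
    exact ⟨mul_ne_zero (mul_ne_zero ht hdet) (mul_ne_zero ht hdet), _, rfl⟩
  · rintro ⟨hD, s, hs⟩
    by_cases h0 : x 0 = 0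
    · have h1 : x 1 ≠ 0 := by rintro h1; simp [h0, h1] at hD
      exact ⟨1, 0, x 1, 1, x 2, one_ne_zero, by simpa using h1, by simp [h0], by simp, by simp⟩
    · have hs0 : s ≠ 0 := by rintro rfl; simp [hs] at hD
      refine ⟨x 0, 1, 1, (x 1 + s) / (2 * x 0), (x 1 - s) / (2 * x 0), h0, ?_, by simp, ?_, ?_⟩
      · have : 1 * ((x 1 - s) / (2 * x 0)) - 1 * ((x 1 + s) / (2 * x 0)) = - s / x 0 := by
          field_simp; ring
        rw [this]
        exact div_ne_zero (neg_ne_zero.mpr hs0) h0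
      · simp
        field_simp
        ring
      · simp
        field_simp
        linear_combination -hs

lemma isSquare_mul_of_not_isSquare {a b : F} (ha : ¬ IsSquare a) (hb : ¬ IsSquare b) :
    IsSquare (a * b) := by
  have ha0 : a ≠ 0 := by rintro rfl; exact ha (IsSquare.zero)
  have hb0 : b ≠ 0 := by rintro rfl; exact hb (IsSquare.zero)
  rw [← quadraticChar_one_iff_isSquare (mul_ne_zero ha0 hb0), map_mul,
    quadraticChar_neg_one_iff_not_isSquare.mpr ha, quadraticChar_neg_one_iff_not_isSquare.mpr hb]
  norm_num

lemma inOrbitBQ_nonsplit_iff (h2 : (2 : F) ≠ 0) {l : F} (hl : ¬ IsSquare l) (x : Fin 3 → F) :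
    InOrbitBQ ![1, 0, -l] x ↔ ¬ IsSquare (discBQ x) := by
  have hl0 : l ≠ 0 := by rintro rfl; exact hl IsSquare.zero
  rw [inOrbitBQ_iff]
  constructor
  · rintro ⟨t, a, b, c, d, ht, hdet, h0, h1, h3⟩ ⟨s, hs⟩
    simp at h0 h1 h3
    rw [discBQ] at hs
    refine hl ⟨s / (2 * t * (a * d - b * c)), ?_⟩
    have h : x 1 ^ 2 - 4 * x 0 * x 2 = l * (2 * t * (a * d - b * c)) ^ 2 := by
      rw [h0, h1, h3]; ring
    have hk : 2 * t * (a * d - b * c) ≠ 0 := mul_ne_zero (mul_ne_zero h2 ht) hdet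
    generalize 2 * t * (a * d - b * c) = k at h hk
    field_simp
    rw [← h, hs]
    ring
  · intro hD
    obtain ⟨w, hw⟩ := isSquare_mul_of_not_isSquare hD hl
    have h0 : x 0 ≠ 0 := by
      intro h0
      exact hD ⟨x 1, by rw [discBQ, h0]; ring⟩
    have hw0 : w ≠ 0 := by
      rintro rfl
      have : discBQ x = 0 := by simpa [hl0] using hw
      exact hD (this ▸ IsSquare.zero)
    rw [discBQ] at hw
    refine ⟨x 0, 1, 0, x 1 / (2 * x 0), w / (l * (2 * x 0)), h0, ?_, by simp, ?_, ?_⟩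
    · have : w / (l * (2 * x 0)) ≠ 0 := div_ne_zero hw0 (mul_ne_zero hl0 (mul_ne_zero h2 h0))
      simpa using this
    · simp
      field_simp
    · simp
      field_simp
      linear_combination -hw

lemma rank_gram2_of_discBQ_ne_zero (h2 : (2 : F) ≠ 0) {x : Fin 3 → F} (hx : discBQ x ≠ 0) :
    (gram2 x).rank = 2 := by
  have hdet : (gram2 x).det = - discBQ x / 2 ^ 2 := by
    rw [gram2, Matrix.det_fin_two_of, discBQ]
    field_simp
    ring
  have hu : IsUnit (gram2 x) := by
    rw [Matrix.isUnit_iff_isUnit_det, hdet, isUnit_iff_ne_zero]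
    exact div_ne_zero (neg_ne_zero.mpr hx) (pow_ne_zero _ h2)
  simpa using Matrix.rank_of_isUnit _ hu

lemma rank_gram2_of_inOrbitBQ_sq (h2 : (2 : F) ≠ 0) {x : Fin 3 → F}
    (hx : InOrbitBQ ![0, 0, 1] x) : (gram2 x).rank = 1 := by
  have hx0 := ((inOrbitBQ_sq_iff h2 x).mp hx).1
  obtain ⟨t, a, b, c, d, -, -, h0, h1, h3⟩ := (inOrbitBQ_iff _ _).mp hx
  simp at h0 h1 h3
  have hg : gram2 x = Matrix.vecMulVec ![t * b, t * d] ![b, d] := by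
    ext i j
    fin_cases i <;> fin_cases j <;> simp [gram2, Matrix.vecMulVec_apply, h0, h1, h3] <;>
      field_simp
  apply le_antisymm
  · rw [hg]
    exact Matrix.rank_vecMulVec_le _ _
  · rw [Nat.one_le_iff_ne_zero]
    intro hr
    have h : gram2 x = 0 := by
      rw [Matrix.rank, Submodule.finrank_eq_zero, LinearMap.range_eq_bot] at hr
      exact Matrix.toLin'.injective (by rwa [map_zero])
    apply hx0
    have e (i j) := congrFun (congrFun h i) j
    funext i
    fin_cases i
    · simpa [gram2] using e 0 0
    · simpa [gram2, h2] using e 0 1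
    · simpa [gram2] using e 1 1

/-- For `a ≠ 0` a form is determined by `a`, `b` and its discriminant; for `a = 0` its
discriminant is `b²`. -/
lemma card_discBQ (h2 : (2 : F) ≠ 0) (P : F → Prop) :
    Nat.card {x : Fin 3 → F // P (discBQ x)} =
      (Fintype.card F - 1) * Fintype.card F * Nat.card {D // P D}
        + Fintype.card F * Nat.card {b : F // P (b ^ 2)} := by
  have key (a b D : F) (ha : a ≠ 0) : discBQ ![a, b, (b ^ 2 - D) / (2 ^ 2 * a)] = D := by
    simp [discBQ]
    field_simp
    ring
  let f : (Fˣ × F × {D // P D}) ⊕ (F × {b : F // P (b ^ 2)}) →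
      {x : Fin 3 → F // P (discBQ x)} :=
    Sum.elim
      (fun y => ⟨![y.1, y.2.1, (y.2.1 ^ 2 - y.2.2) / (2 ^ 2 * y.1)], by
        rw [key _ _ _ y.1.ne_zero]; exact y.2.2.2⟩)
      (fun y => ⟨![0, y.2, y.1], by simpa [discBQ] using y.2.2⟩)
  have hf : Function.Bijective f := by
    constructor
    · rintro (⟨a, b, D, hD⟩ | ⟨c, b, hb⟩) (⟨a', b', D', hD'⟩ | ⟨c', b', hb'⟩) h
      · have h := congrArg Subtype.val h
        have hd := congrArg discBQ h
        simp only [f, Sum.elim_inl, key _ _ _ (Units.ne_zero _)] at h hd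
        have ha : a = a' := Units.ext (by simpa using congrFun h 0)
        have hb : b = b' := by simpa using congrFun h 1
        subst ha hb hd
        rfl
      · have h := congrFun (congrArg Subtype.val h) 0
        simp [f] at h
      · have h := congrFun (congrArg Subtype.val h) 0
        exact absurd h.symm a'.ne_zero
      · have h := congrArg Subtype.val h
        have hb : b = b' := by simpa [f] using congrFun h 1
        have hc : c = c' := by simpa [f] using congrFun h 2
        subst hb hc
        rfl
    · rintro ⟨x, hx⟩
      by_cases h0 : x 0 = 0
      · refine ⟨.inr (x 2, ⟨x 1, by simpa [discBQ, h0] using hx⟩), Subtype.ext ?_⟩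
        funext i
        fin_cases i <;> simp [f, h0]
      · refine ⟨.inl (Units.mk0 _ h0, x 1, ⟨discBQ x, hx⟩), Subtype.ext ?_⟩
        funext i
        fin_cases i
        · simp [f]
        · simp [f]
        · simp [f, discBQ]
          field_simp
          ring
  rw [← Nat.card_eq_of_bijective f hf]
  simp only [Nat.card_sum, Nat.card_prod, Nat.card_units, Nat.card_eq_fintype_card (α := F),
    mul_assoc]

lemma card_isSquare_and_card_not_isSquare (hF : ringChar F ≠ 2) :
    2 * (Nat.card {D : F // D ≠ 0 ∧ IsSquare D} : ℚ) = Fintype.card F - 1 ∧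
      2 * (Nat.card {D : F // ¬ IsSquare D} : ℚ) = Fintype.card F - 1 := by
  have hS : (Nat.card {D : F // D ≠ 0 ∧ IsSquare D} : ℚ) =
      ∑ D : F, if D ≠ 0 ∧ IsSquare D then 1 else 0 := by
    rw [Nat.card_eq_fintype_card, Fintype.card_subtype, Finset.sum_boole]
  have hN : (Nat.card {D : F // ¬ IsSquare D} : ℚ) =
      ∑ D : F, if ¬ IsSquare D then 1 else 0 := by
    rw [Nat.card_eq_fintype_card, Fintype.card_subtype, Finset.sum_boole]
  have hsum : ∑ D : F, (if D = 0 then (0 : ℚ) else 1) = Fintype.card F - 1 := by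
    have h (D : F) : (if D = 0 then (0 : ℚ) else 1) = 1 - if D = 0 then 1 else 0 := by
      split_ifs <;> simp
    simp [h, Finset.sum_sub_distrib]
  have hdiff : ∑ D : F, (quadraticChar F D : ℚ) = 0 := by
    exact_mod_cast quadraticChar_sum_zero hF
  have hchar (D : F) : (quadraticChar F D : ℚ) =
      if D = 0 then 0 else if IsSquare D then 1 else -1 := by
    simp only [quadraticChar_apply, quadraticCharFun]
    split_ifs <;> simp
  rw [hS, hN, Finset.mul_sum, Finset.mul_sum, ← hsum]
  constructor
  · refine Eq.trans ?_ ((congrArg (_ + ·) hdiff).trans (add_zero _))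
    rw [← Finset.sum_add_distrib]
    refine Finset.sum_congr rfl fun D _ => ?_
    rw [hchar]
    by_cases hD : D = 0 <;> by_cases hs : IsSquare D <;> (simp [hD, hs]; try norm_num)
  · refine Eq.trans ?_ ((congrArg (_ - ·) hdiff).trans (sub_zero _))
    rw [← Finset.sum_sub_distrib]
    refine Finset.sum_congr rfl fun D _ => ?_
    rw [hchar]
    by_cases hD : D = 0 <;> by_cases hs : IsSquare D <;> (simp [hD, hs]; try norm_num)

lemma card_inOrbitBQ_sq (h2 : (2 : F) ≠ 0) :
    (Nat.card {x : Fin 3 → F // InOrbitBQ ![0, 0, 1] x} : ℚ) = (Fintype.card F : ℚ) ^ 2 - 1 := by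
  have hq : 1 ≤ Fintype.card F := Fintype.card_pos
  have hD : Nat.card {x : Fin 3 → F // discBQ x = 0} = Fintype.card F ^ 2 := by
    rw [card_discBQ h2 (· = 0)]
    obtain ⟨n, hn⟩ := Nat.exists_eq_add_of_le hq
    simp [hn]
    ring
  have h0 : (0 : Fin 3 → F) ∈ {x : Fin 3 → F | discBQ x = 0} := by simp [discBQ]
  have h := Set.ncard_sdiff_singleton_add_one h0
  have heq : {x : Fin 3 → F | InOrbitBQ ![0, 0, 1] x} = {x | discBQ x = 0} \ {0} := by
    ext x
    simp [inOrbitBQ_sq_iff h2, and_comm]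
  rw [← heq, ← Nat.card_coe_set_eq, ← Nat.card_coe_set_eq] at h
  rw [eq_sub_iff_add_eq]
  exact_mod_cast h.trans hD

lemma card_inOrbitBQ_split (hF : ringChar F ≠ 2) :
    (Nat.card {x : Fin 3 → F // InOrbitBQ ![0, 1, 0] x} : ℚ) =
      (Fintype.card F : ℚ) * ((Fintype.card F : ℚ) ^ 2 - 1) / 2 := by
  have h2 : (2 : F) ≠ 0 := Ring.two_ne_zero hF
  have hb : Nat.card {b : F // b ^ 2 ≠ 0 ∧ IsSquare (b ^ 2)} = Fintype.card F - 1 := by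
    simp [IsSquare.sq, Fintype.card_subtype_compl]
  simp_rw [inOrbitBQ_split_iff h2]
  rw [card_discBQ h2 (fun D => D ≠ 0 ∧ IsSquare D), hb]
  push_cast [Nat.cast_sub (Fintype.card_pos : 0 < Fintype.card F)]
  linear_combination ((Fintype.card F : ℚ) - 1) * Fintype.card F / 2 *
    (card_isSquare_and_card_not_isSquare hF).1

lemma card_inOrbitBQ_nonsplit (hF : ringChar F ≠ 2) {l : F} (hl : ¬ IsSquare l) :
    (Nat.card {x : Fin 3 → F // InOrbitBQ ![1, 0, -l] x} : ℚ) =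
      (Fintype.card F : ℚ) * ((Fintype.card F : ℚ) - 1) ^ 2 / 2 := by
  have h2 : (2 : F) ≠ 0 := Ring.two_ne_zero hF
  have hb : Nat.card {b : F // ¬ IsSquare (b ^ 2)} = 0 := by simp [IsSquare.sq]
  simp_rw [inOrbitBQ_nonsplit_iff h2 hl]
  rw [card_discBQ h2 (fun D => ¬ IsSquare D), hb]
  push_cast [Nat.cast_sub (Fintype.card_pos : 0 < Fintype.card F)]
  linear_combination ((Fintype.card F : ℚ) - 1) * Fintype.card F / 2 *
    (card_isSquare_and_card_not_isSquare hF).2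

/-- orbits of `GL₁(F_q) × GL₂(F_q)` on binary quadratic forms, `p ≠ 2`. -/
theorem stmt10 (p : ℕ) [Fact p.Prime] [CharP F p] (hp : p ≠ 2) (l : F) (hl : ¬ IsSquare l) :
    let r : Fin 4 → Fin 3 → F := ![![0,0,0], ![0,0,1], ![0,1,0], ![1,0,-l]]
    let q : ℚ := (Fintype.card F : ℚ)
    (∀ i j : Fin 4, i ≠ j → ¬ ∃ x : Fin 3 → F, InOrbitBQ (r i) x ∧ InOrbitBQ (r j) x) ∧
    (∀ x : Fin 3 → F, ∃ i : Fin 4, InOrbitBQ (r i) x) ∧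
    (∀ (i : Fin 4) (x : Fin 3 → F), InOrbitBQ (r i) x → (gram2 x).rank = ![0,1,2,2] i) ∧
    (∀ i : Fin 4, (Nat.card {x : Fin 3 → F // InOrbitBQ (r i) x} : ℚ) =
      ![1, q^2 - 1, q*(q^2 - 1)/2, q*(q - 1)^2/2] i) := by
  have hF : ringChar F ≠ 2 := by rwa [ringChar.eq F p]
  have h2 : (2 : F) ≠ 0 := Ring.two_ne_zero hF
  have hdisc0 : discBQ (0 : Fin 3 → F) = 0 := by simp [discBQ]
  intro r q
  have o0 (x) : InOrbitBQ (r 0) x ↔ x = 0 := inOrbitBQ_zero_iff x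
  have o1 (x) : InOrbitBQ (r 1) x ↔ x ≠ 0 ∧ discBQ x = 0 := inOrbitBQ_sq_iff h2 x
  have o2 (x) : InOrbitBQ (r 2) x ↔ discBQ x ≠ 0 ∧ IsSquare (discBQ x) :=
    inOrbitBQ_split_iff h2 x
  have o3 (x) : InOrbitBQ (r 3) x ↔ ¬ IsSquare (discBQ x) := inOrbitBQ_nonsplit_iff h2 hl x
  have hsq : IsSquare (0 : F) := IsSquare.zero
  refine ⟨?_, ?_, ?_, ?_⟩
  · rintro i j hij ⟨x, hi, hj⟩
    fin_cases i <;> fin_cases j <;> first | exact hij rfl | skip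
    all_goals
      simp only [Fin.zero_eta, Fin.mk_one, Fin.reduceFinMk, o0, o1, o2, o3] at hi hj
      grind
  · intro x
    by_cases hx : x = 0
    · exact ⟨0, (o0 x).mpr hx⟩
    by_cases hd : discBQ x = 0
    · exact ⟨1, (o1 x).mpr ⟨hx, hd⟩⟩
    by_cases hs : IsSquare (discBQ x)
    · exact ⟨2, (o2 x).mpr ⟨hd, hs⟩⟩
    · exact ⟨3, (o3 x).mpr hs⟩
  · intro i x hx
    fin_cases i
    · obtain rfl := (o0 x).mp hx
      have : gram2 (0 : Fin 3 → F) = 0 := by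
        ext i j
        fin_cases i <;> fin_cases j <;> simp [gram2]
      simp [this]
    · exact rank_gram2_of_inOrbitBQ_sq h2 hx
    · exact rank_gram2_of_discBQ_ne_zero h2 ((o2 x).mp hx).1
    · refine rank_gram2_of_discBQ_ne_zero h2 fun h => (o3 x).mp hx ?_
      rwa [h]
  · intro i
    fin_cases i
    · have : Nat.card {x : Fin 3 → F // InOrbitBQ (r 0) x} = 1 := by simp [o0]
      simpa using this
    · exact card_inOrbitBQ_sq h2
    · exact card_inOrbitBQ_split hF
    · exact card_inOrbitBQ_nonsplit hF hl

end
end
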